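/- arXiv:2603.21587 — 5 statements merged into one kernel-verified Lean document; each statement's English description precedes it below -/
import Mathlib

section
/- Let (R,𝔪) be a Cohen-Macaulay local ring with canonical module that is generically Gorenstein and not Gorenstein, let ω be a canonical ideal of R, and let x ∈ ω be an R-regular element. Applying Hom_R(−, ω) to the short exact sequence 0 → xR/xω → ω/xω → ω/xR → 0 of codimension-one Cohen-Macaulay R-modules yields a short exact sequence 0 → Ext^1_R(ω/xR, ω) → R/xR → R/ω → 0. -/
open CategoryTheory

noncomputable section

/-- The Ext module `Ext^n_R(M, N)` for `R`-modules `M`, `N`. -/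
abbrev ModExt (R : Type) [CommRing R] (n : ℕ) (M N : ModuleCat R) : ModuleCat R :=
  ((Ext R (ModuleCat R) n).obj (Opposite.op M)).obj N

/-- An `R`-module `M` has finite injective dimension if `Ext^i_R(-, M)` vanishes
for all `i` beyond some bound. -/
def HasFiniteInjDim (R : Type) [CommRing R] (M : ModuleCat R) : Prop :=
  ∃ n : ℕ, ∀ (N : ModuleCat R) (i : ℕ), n < i → Subsingleton (ModExt R i N M)

/-- The depth of a module over a local ring, via Rees' characterization:
the least `n` with `Ext^n(k, M) ≠ 0`. -/
def moduleDepth (R : Type) [CommRing R] [IsLocalRing R] (M : ModuleCat R) : ℕ∞ :=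
  sInf {n : ℕ∞ | ∃ m : ℕ, n = (m : ℕ∞) ∧
    Nontrivial (ModExt R m (ModuleCat.of R (IsLocalRing.ResidueField R)) M)}

/-- A Noetherian local ring is Cohen-Macaulay if its depth equals its Krull dimension. -/
def IsCMLocalRing (R : Type) [CommRing R] [IsLocalRing R] : Prop :=
  IsNoetherianRing R ∧
    (moduleDepth R (ModuleCat.of R R) : WithBot ℕ∞) = ringKrullDim R

/-- A maximal Cohen-Macaulay module: finitely generated with depth equal to `dim R`. -/
def IsMCM (R : Type) [CommRing R] [IsLocalRing R] (X : ModuleCat R) : Prop :=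
  Module.Finite R X ∧ (moduleDepth R X : WithBot ℕ∞) = ringKrullDim R

/-- A Cohen-Macaulay module of codimension one:
`depth M = dim M = dim R - 1`. -/
def IsCMofCodimOne (R : Type) [CommRing R] [IsLocalRing R] (M : ModuleCat R) : Prop :=
  Module.Finite R M ∧ ∃ d : ℕ, ringKrullDim R = ((d + 1 : ℕ) : WithBot ℕ∞) ∧
    moduleDepth R M = (d : ℕ∞) ∧
    ringKrullDim (R ⧸ Module.annihilator R M) = ((d : ℕ) : WithBot ℕ∞)

/-- A Gorenstein local ring: Noetherian local with finite injective dimension over itself. -/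
def IsGorensteinLocalRing (A : Type) [CommRing A] : Prop :=
  IsNoetherianRing A ∧ IsLocalRing A ∧ HasFiniteInjDim A (ModuleCat.of A A)

/-- `R` is generically Gorenstein if its localization at every minimal prime is Gorenstein. -/
def IsGenericallyGorenstein (R : Type) [CommRing R] : Prop :=
  ∀ p ∈ minimalPrimes R, ∀ h : p.IsPrime,
    letI := h
    IsGorensteinLocalRing (Localization.AtPrime p)

/-- A canonical module of a local ring `R`: finitely generated, of finite injective
dimension, with `Ext^i(k, ω) ≅ k` for `i = dim R` and `Ext^i(k, ω) = 0` otherwise. -/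
def IsCanonicalModule (R : Type) [CommRing R] [IsLocalRing R] (W : ModuleCat R) : Prop :=
  Module.Finite R W ∧ HasFiniteInjDim R W ∧
    ∃ d : ℕ, ringKrullDim R = (d : ℕ) ∧
      Nonempty ((ModExt R d (ModuleCat.of R (IsLocalRing.ResidueField R)) W) ≃ₗ[R]
        IsLocalRing.ResidueField R) ∧
      ∀ i : ℕ, i ≠ d →
        Subsingleton (ModExt R i (ModuleCat.of R (IsLocalRing.ResidueField R)) W)

/-- A canonical ideal: an ideal of `R` which, as an `R`-module, is a canonical module. -/
def IsCanonicalIdeal (R : Type) [CommRing R] [IsLocalRing R] (I : Ideal R) : Prop :=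
  IsCanonicalModule R (ModuleCat.of R I)

/-- `Y` and `X` have a common nonzero direct summand via the map `ι : Y → X`. -/
def HasCommonSummandVia (R : Type) [CommRing R] {Y X : ModuleCat R}
    (ι : Y →ₗ[R] X) : Prop :=
  ∃ (N Y' X' : ModuleCat.{0} R), Nontrivial N ∧
    ∃ (e : Y ≃ₗ[R] N × Y') (f : X ≃ₗ[R] N × X') (ι' : Y' →ₗ[R] X'),
      ∀ y : Y, f (ι y) = ((e y).1, ι' (e y).2)

/-- `0 → Y → X → M → 0` is an MCM approximation of `M`. -/
def IsMCMApprox (R : Type) [CommRing R] [IsLocalRing R] (M Y X : ModuleCat R)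
    (ι : Y →ₗ[R] X) (π : X →ₗ[R] M) : Prop :=
  Module.Finite R M ∧ Module.Finite R Y ∧ IsMCM R X ∧ HasFiniteInjDim R Y ∧
    Function.Injective ι ∧ Function.Surjective π ∧ Function.Exact ι π

/-- `0 → Y → X → M → 0` is a minimal MCM approximation of `M`. -/
def IsMinMCMApprox (R : Type) [CommRing R] [IsLocalRing R] (M Y X : ModuleCat R)
    (ι : Y →ₗ[R] X) (π : X →ₗ[R] M) : Prop :=
  IsMCMApprox R M Y X ι π ∧ ¬ HasCommonSummandVia R ι

/-- `0 → M → Y → X → 0` is an FID hull of `M`. -/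
def IsFIDHull (R : Type) [CommRing R] [IsLocalRing R] (M Y X : ModuleCat R)
    (ι : M →ₗ[R] Y) (π : Y →ₗ[R] X) : Prop :=
  Module.Finite R M ∧ Module.Finite R Y ∧ HasFiniteInjDim R Y ∧
    (IsMCM R X ∨ Subsingleton X) ∧
    Function.Injective ι ∧ Function.Surjective π ∧ Function.Exact ι π

/-- `0 → M → Y → X → 0` is a minimal FID hull of `M`. -/
def IsMinFIDHull (R : Type) [CommRing R] [IsLocalRing R] (M Y X : ModuleCat R)
    (ι : M →ₗ[R] Y) (π : Y →ₗ[R] X) : Prop :=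
  IsFIDHull R M Y X ι π ∧ ¬ HasCommonSummandVia R π

/-- The free rank of a module: the largest `m` with `R^m` a direct summand. -/
def freeRank (R : Type) [CommRing R] (X : ModuleCat R) : ℕ∞ :=
  sSup {n : ℕ∞ | ∃ m : ℕ, n = (m : ℕ∞) ∧
    ∃ X' : ModuleCat.{0} R, Nonempty (X ≃ₗ[R] ((Fin m → R) × X'))}

/-- The `W`-rank of a module: the largest `m` with `W^m` a direct summand. -/
def wRank (R : Type) [CommRing R] (W X : ModuleCat R) : ℕ∞ :=
  sSup {n : ℕ∞ | ∃ m : ℕ, n = (m : ℕ∞) ∧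
    ∃ X' : ModuleCat.{0} R, Nonempty (X ≃ₗ[R] ((Fin m → W) × X'))}

/-- `M` and `N` are `W`-stably isomorphic. -/
def WStablyIso (R : Type) [CommRing R] (W M N : ModuleCat R) : Prop :=
  ∃ s t : ℕ, Nonempty ((M × (Fin s → W)) ≃ₗ[R] (N × (Fin t → W)))

/-- The quotient module `I/J` (realized as `I` modulo the elements of `J` lying in `I`). -/
abbrev qmod (R : Type) [CommRing R] (I J : Ideal R) : ModuleCat R :=
  ModuleCat.of R (I ⧸ (Submodule.comap I.subtype J))

namespace CategoryTheory.ProjectiveResolution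

section

universe w v u

variable {C : Type u} [Category.{v} C] [Abelian C] [HasExt.{w} C]
  {X Y : C} (P : ProjectiveResolution X)

open CochainComplex HomComplex in
lemma extMk_zero_eq_zero_iff (f : P.complex.X 0 ⟶ Y) (hf : P.complex.d 1 0 ≫ f = 0) :
    P.extMk f 1 rfl hf = 0 ↔ f = 0 := by
  refine ⟨fun h ↦ ?_, fun h ↦ by subst h; simp⟩
  rw [← P.extEquivCohomologyClass.apply_eq_iff_eq,
    extEquivCohomologyClass_extMk, extEquivCohomologyClass_zero,
    CohomologyClass.mk_eq_zero_iff, Cocycle.toSingleMk_mem_coboundaries_iff _ _ _ _ _ 1 (by lia)]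
    at h
  obtain ⟨g, hg⟩ := h
  have h1 : Limits.IsZero (P.cochainComplex.X 1) :=
    P.cochainComplex.isZero_of_isStrictlyLE 0 1 (by lia)
  rw [h1.eq_of_src g 0, Limits.comp_zero] at hg
  exact (cancel_epi (P.cochainComplexXIso (-(0 : ℕ)) 0 rfl).hom).mp (by simpa using hg.symm)

lemma smul_extMk {A : Type*} [Ring A] [Linear A C] (r : A) {n : ℕ} (f : P.complex.X n ⟶ Y) (m : ℕ)
    (hm : n + 1 = m) (hf : P.complex.d m n ≫ f = 0) :
    r • P.extMk f m hm hf = P.extMk (r • f) m hm (by simp [hf]) := by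
  rw [Abelian.Ext.smul_eq_comp_mk₀, extMk_comp_mk₀]
  simp

end

variable {R : Type} [CommRing R] {X Y : ModuleCat.{0} R} (P : ProjectiveResolution X)

/-- The class in `Ext` of a cocycle, as a linear map. -/
def extMkLinear (n : ℕ) :
    LinearMap.ker ((P.complex.linearYonedaObj R Y).sc' ((ComplexShape.up ℕ).prev n) n
      (n + 1)).g.hom →ₗ[R] Abelian.Ext X Y n where
  toFun f := P.extMk (f.1 : P.complex.X n ⟶ Y) (n + 1) rfl f.2
  map_add' _ _ := (P.add_extMk _ _ _ _ _ _).symm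
  map_smul' r _ := (P.smul_extMk r _ _ _ _).symm

lemma extMkLinear_surjective (n : ℕ) : Function.Surjective (P.extMkLinear (Y := Y) n) := by
  intro α
  obtain ⟨f, hf, rfl⟩ := P.extMk_surjective α (n + 1) rfl
  exact ⟨⟨f, hf⟩, rfl⟩

lemma ker_extMkLinear (n : ℕ) :
    LinearMap.ker (P.extMkLinear (Y := Y) n) =
      LinearMap.range ((P.complex.linearYonedaObj R Y).sc' ((ComplexShape.up ℕ).prev n) n
        (n + 1)).moduleCatToCycles := by
  ext ⟨f, hf⟩
  cases n with
  | zero =>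
    refine (P.extMk_zero_eq_zero_iff f hf).trans ⟨fun h ↦ ⟨0, Subtype.ext ?_⟩, ?_⟩
    · exact (map_zero _).trans h.symm
    · rintro ⟨g, hg⟩
      have h0 : (P.complex.linearYonedaObj R Y).d ((ComplexShape.up ℕ).prev 0) 0 = 0 :=
        HomologicalComplex.shape _ _ _ (by simp)
      refine (congrArg Subtype.val hg).symm.trans ?_
      change ((P.complex.linearYonedaObj R Y).d ((ComplexShape.up ℕ).prev 0) 0).hom g = 0
      rw [h0]
      rfl
  | succ n =>
    have hp : (ComplexShape.up ℕ).prev (n + 1) = n := by simp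
    rw [hp]
    refine (P.extMk_eq_zero_iff f (n + 2) rfl hf n rfl).trans ⟨?_, ?_⟩
    · rintro ⟨g, hg⟩
      exact ⟨g, Subtype.ext hg⟩
    · rintro ⟨g, hg⟩
      exact ⟨g, congrArg Subtype.val hg⟩

/-- `Abelian.Ext` is the cohomology of the complex of morphisms from a projective resolution. -/
def cohomologyLinearEquivExt (n : ℕ) :
    (LinearMap.ker ((P.complex.linearYonedaObj R Y).sc' ((ComplexShape.up ℕ).prev n) n
      (n + 1)).g.hom ⧸ LinearMap.range ((P.complex.linearYonedaObj R Y).sc'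
        ((ComplexShape.up ℕ).prev n) n (n + 1)).moduleCatToCycles) ≃ₗ[R] Abelian.Ext X Y n :=
  (Submodule.quotEquivOfEq _ _ (P.ker_extMkLinear n).symm).trans
    ((P.extMkLinear n).quotKerEquivOfSurjective (P.extMkLinear_surjective n))

end CategoryTheory.ProjectiveResolution

/-- The derived functor `Ext` agrees with `Abelian.Ext`. -/
def modExtLinearEquiv (R : Type) [CommRing R] (n : ℕ) (M N : ModuleCat.{0} R) :
    ModExt R n M N ≃ₗ[R] Abelian.Ext M N n :=
  let P := projectiveResolution M
  (P.isoExt (R := R) n N ≪≫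
    ShortComplex.homologyMapIso ((P.complex.linearYonedaObj R N).isoSc' _ n (n + 1) rfl
      (by simp)) ≪≫
    ShortComplex.moduleCatHomologyIso _).toLinearEquiv.trans (P.cohomologyLinearEquivExt n)

open IsLocalRing
open scoped Pointwise

section ShortExact

variable {R : Type} [CommRing R] {S : ShortComplex (ModuleCat.{0} R)} (hS : S.ShortExact)
  (N : ModuleCat.{0} R)

include hS in
lemma subsingleton_ext_middle {i : ℕ} (h₁ : Subsingleton (Abelian.Ext S.X₁ N i))
    (h₃ : Subsingleton (Abelian.Ext S.X₃ N i)) : Subsingleton (Abelian.Ext S.X₂ N i) := by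
  refine subsingleton_of_forall_eq 0 fun x ↦ ?_
  obtain ⟨y, rfl⟩ := Abelian.Ext.contravariant_sequence_exact₂ hS N x (Subsingleton.elim _ _)
  rw [Subsingleton.elim y 0]
  simp

include hS in
lemma subsingleton_ext_right {i : ℕ} (h₂ : Subsingleton (Abelian.Ext N S.X₂ i))
    (h₁ : Subsingleton (Abelian.Ext N S.X₁ (i + 1))) : Subsingleton (Abelian.Ext N S.X₃ i) := by
  refine subsingleton_of_forall_eq 0 fun x ↦ ?_
  obtain ⟨y, rfl⟩ := Abelian.Ext.covariant_sequence_exact₃ N hS x rfl (Subsingleton.elim _ _)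
  rw [Subsingleton.elim y 0]
  simp

include hS in
lemma length_ext_middle {i : ℕ} (h : Subsingleton (Abelian.Ext S.X₃ N (i + 1)))
    (h' : ∀ j, j + 1 = i → Subsingleton (Abelian.Ext S.X₁ N j)) :
    Module.length R (Abelian.Ext S.X₂ N i) =
      Module.length R (Abelian.Ext S.X₃ N i) + Module.length R (Abelian.Ext S.X₁ N i) := by
  refine Module.length_eq_add_of_exact
    ((Abelian.Ext.mk₀ S.g).precompOfLinear R N (zero_add i))
    ((Abelian.Ext.mk₀ S.f).precompOfLinear R N (zero_add i)) ?_ ?_ ?_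
  · refine (injective_iff_map_eq_zero _).mpr fun x hx ↦ ?_
    cases i with
    | zero =>
      obtain ⟨g, rfl⟩ := Abelian.Ext.addEquiv₀.symm.surjective x
      have := hS.epi_g
      simpa [← cancel_epi S.g] using hx
    | succ j =>
      obtain ⟨y, rfl⟩ := Abelian.Ext.contravariant_sequence_exact₃ hS N x hx (add_comm 1 j)
      rw [(h' j rfl).elim y 0]
      simp
  · intro x
    exact Abelian.Ext.contravariant_sequence_exact₁ hS N x (add_comm 1 i) (h.elim _ _)
  · exact (ShortComplex.ab_exact_iff_function_exact _).mp
      (Abelian.Ext.contravariant_sequence_exact₂' hS N i)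

end ShortExact

section Congr

variable {R : Type} [CommRing R] {M M' : ModuleCat.{0} R}

/-- Isomorphic modules have isomorphic `Ext` modules. -/
def extCongrLeft (e : M ≅ M') (N : ModuleCat.{0} R) (i : ℕ) :
    Abelian.Ext M N i ≃ₗ[R] Abelian.Ext M' N i :=
  LinearEquiv.ofLinearMap ((Abelian.Ext.mk₀ e.inv).precompOfLinear R N (zero_add i))
    ((Abelian.Ext.mk₀ e.hom).precompOfLinear R N (zero_add i)) (by ext; simp) (by ext; simp)

/-- `Ext⁰` is the module of linear maps. -/
def extZeroLinearEquiv (M N : ModuleCat.{0} R) : Abelian.Ext M N 0 ≃ₗ[R] (M →ₗ[R] N) :=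
  Abelian.Ext.linearEquiv₀.trans ModuleCat.homLinearEquiv

lemma subsingleton_ext_of_subsingleton (hM : Subsingleton M) (N : ModuleCat.{0} R) (i : ℕ) :
    Subsingleton (Abelian.Ext M N i) := by
  refine subsingleton_of_forall_eq 0 fun x ↦ ?_
  rw [← Abelian.Ext.mk₀_id_comp x, (ModuleCat.isZero_of_subsingleton M).eq_of_src (𝟙 M) 0]
  simp

/-- The short complex attached to an exact sequence of linear maps. -/
abbrev shortComplexOfExact {A B C : Type} [AddCommGroup A] [AddCommGroup B] [AddCommGroup C]
    [Module R A] [Module R B] [Module R C] (f : A →ₗ[R] B) (g : B →ₗ[R] C)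
    (hfg : Function.Exact f g) : ShortComplex (ModuleCat.{0} R) :=
  ModuleCat.shortComplexOfCompEqZero f g hfg.linearMap_comp_eq_zero

lemma shortExact_shortComplexOfExact {A B C : Type} [AddCommGroup A] [AddCommGroup B]
    [AddCommGroup C] [Module R A] [Module R B] [Module R C] {f : A →ₗ[R] B} {g : B →ₗ[R] C}
    (hfg : Function.Exact f g) (hf : Function.Injective f) (hg : Function.Surjective g) :
    (shortComplexOfExact f g hfg).ShortExact :=
  ModuleCat.shortComplex_shortExact _ hfg hf hg

end Congr

section Local

variable {R : Type} [CommRing R] [IsLocalRing R]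

lemma subsingleton_of_forall_exists_smul_eq {E : Type} [AddCommGroup E] [Module R E]
    [Module.Finite R E] {y : R} (hy : y ∈ maximalIdeal R) (h : ∀ e : E, ∃ e', y • e' = e) :
    Subsingleton E := by
  have h1 : (⊤ : Submodule R E) ≤ maximalIdeal R • ⊤ := by
    intro e _
    obtain ⟨e', rfl⟩ := h e
    exact Submodule.smul_mem_smul hy trivial
  exact (Submodule.subsingleton_iff R).mp (subsingleton_of_bot_eq_top
    (Submodule.eq_bot_of_le_smul_of_le_jacobson_bot _ _ Module.Finite.fg_top h1
      (maximalIdeal_le_jacobson _)).symm)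

variable [IsNoetherianRing R]

lemma subsingleton_ext_of_isSMulRegular (M N : ModuleCat.{0} R) [Module.Finite R M]
    [Module.Finite R N] {y : R} (hy : y ∈ maximalIdeal R) (hreg : IsSMulRegular M y) {i : ℕ}
    (h : Subsingleton (Abelian.Ext (ModuleCat.of R (QuotSMulTop y M)) N (i + 1))) :
    Subsingleton (Abelian.Ext M N i) := by
  refine subsingleton_of_forall_exists_smul_eq hy fun e ↦ ?_
  obtain ⟨e', he'⟩ : ∃ e' : Abelian.Ext M N i,
      (Abelian.Ext.mk₀ (y • 𝟙 M)).comp e' (zero_add i) = e :=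
    Abelian.Ext.contravariant_sequence_exact₁ hreg.smulShortComplex_shortExact N e
      (add_comm 1 i) (h.elim _ _)
  refine ⟨e', ?_⟩
  rw [← he', Abelian.Ext.mk₀_smul]
  simp

lemma exists_isSMulRegular_of_subsingleton_ext (M : ModuleCat.{0} R) [Module.Finite R M]
    (h : Subsingleton (Abelian.Ext (ModuleCat.of R (ResidueField R)) M 0)) :
    ∃ y ∈ maximalIdeal R, IsSMulRegular M y := by
  have h' : Subsingleton (ResidueField R →ₗ[R] M) :=
    (extZeroLinearEquiv (ModuleCat.of R (ResidueField R)) M).symm.subsingleton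
  obtain ⟨y, hy, hreg⟩ := IsSMulRegular.subsingleton_linearMap_iff.mp h'
  exact ⟨y, Ideal.annihilator_quotient.le hy, hreg⟩

/-- Vanishing of `Ext` modules of the residue field above a given degree propagates to cyclic
modules with prime annihilator. -/
lemma subsingleton_ext_quotient_prime (N : ModuleCat.{0} R) [Module.Finite R N] {D : ℕ}
    (h : ∀ i, D < i → Subsingleton (Abelian.Ext (ModuleCat.of R (ResidueField R)) N i))
    (p : Ideal R) (hp : p.IsPrime) {i : ℕ} (hi : D < i) :
    Subsingleton (Abelian.Ext (ModuleCat.of R (R ⧸ p)) N i) := by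
  induction p using IsNoetherian.induction generalizing i with
  | hgt p ih =>
  by_cases hpm : p = maximalIdeal R
  · subst hpm
    exact h i hi
  obtain ⟨y, hym, hyp⟩ := SetLike.exists_of_lt ((le_maximalIdeal hp.ne_top).lt_of_ne hpm)
  have hreg : IsSMulRegular (R ⧸ p) y := by
    refine (isSMulRegular_quotient_iff_mem_of_smul_mem _ _).mpr fun m hm ↦ ?_
    exact (hp.mem_or_mem hm).resolve_left hyp
  refine subsingleton_ext_of_isSMulRegular (ModuleCat.of R (R ⧸ p)) N hym hreg ?_
  have key (M : Type) [AddCommGroup M] [Module R M] (hM : Module.Finite R M)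
      (hann : ∀ a ∈ p ⊔ Ideal.span {y}, ∀ m : M, a • m = 0) :
      Subsingleton (Abelian.Ext (ModuleCat.of R M) N (i + 1)) := by
    induction hM using IsNoetherianRing.induction_on_isQuotientEquivQuotientPrime with
    | subsingleton M => exact subsingleton_ext_of_subsingleton ‹_› N (i + 1)
    | quotient M q e =>
      have hq (a : R) (ha : a ∈ p ⊔ Ideal.span {y}) : a ∈ q.1 := by
        have h1 : a • (Ideal.Quotient.mk q.1 1) = 0 := by
          obtain ⟨m, hm⟩ := e.surjective (Ideal.Quotient.mk q.1 1)
          rw [← hm, ← map_smul, hann a ha, map_zero]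
        rw [← Ideal.Quotient.eq_zero_iff_mem]
        simpa [Algebra.smul_def] using h1
      have hpq : p < q.1 := by
        refine SetLike.lt_iff_le_and_exists.mpr ⟨fun a ha ↦ hq a (Ideal.mem_sup_left ha), y,
          hq y (Ideal.mem_sup_right (Ideal.mem_span_singleton_self y)), hyp⟩
      have := ih q.1 hpq q.2 (i := i + 1) (by omega)
      exact (extCongrLeft e.toModuleIso N (i + 1)).subsingleton
    | exact N₁ N₂ N₃ f g hf hg hfg h₁ h₃ =>
      refine subsingleton_ext_middle (shortExact_shortComplexOfExact hfg hf hg) N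
        (h₁ fun a ha m ↦ hf ?_) (h₃ fun a ha m ↦ ?_)
      · rw [map_smul, hann a ha, map_zero]
      · obtain ⟨m, rfl⟩ := hg m
        rw [← map_smul, hann a ha, map_zero]
  refine key _ inferInstance fun a ha ↦ Module.mem_annihilator.mp ?_
  refine (sup_le (fun b hb ↦ ?_) ?_ : p ⊔ Ideal.span {y} ≤ _) ha
  · refine Module.mem_annihilator.mpr fun m ↦ ?_
    obtain ⟨m, rfl⟩ := Submodule.mkQ_surjective _ m
    obtain ⟨r, rfl⟩ := Ideal.Quotient.mk_surjective m
    have : b • Ideal.Quotient.mk p r = 0 := by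
      rw [Algebra.smul_def, Ideal.Quotient.algebraMap_eq, ← map_mul]
      exact Ideal.Quotient.eq_zero_iff_mem.mpr (Ideal.mul_mem_right r p hb)
    rw [← map_smul, this, map_zero]
  · rw [Ideal.span_singleton_le_iff_mem]
    refine Module.mem_annihilator.mpr fun m ↦ ?_
    obtain ⟨m, rfl⟩ := Submodule.mkQ_surjective _ m
    rw [← map_smul]
    exact (Submodule.Quotient.mk_eq_zero _).mpr (Submodule.smul_mem_pointwise_smul m y ⊤ trivial)

/-- If the higher `Ext` modules of the residue field into `N` vanish, so do those of every finitely
generated module. -/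
lemma subsingleton_ext_of_residueField (N : ModuleCat.{0} R) [Module.Finite R N] {D : ℕ}
    (h : ∀ i, D < i → Subsingleton (Abelian.Ext (ModuleCat.of R (ResidueField R)) N i))
    (M : Type) [AddCommGroup M] [Module R M] (hM : Module.Finite R M) {i : ℕ} (hi : D < i) :
    Subsingleton (Abelian.Ext (ModuleCat.of R M) N i) := by
  induction hM using IsNoetherianRing.induction_on_isQuotientEquivQuotientPrime with
  | subsingleton M => exact subsingleton_ext_of_subsingleton ‹_› N i
  | quotient M q e =>
    have := subsingleton_ext_quotient_prime N h q.1 q.2 hi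
    exact (extCongrLeft e.toModuleIso N i).subsingleton
  | exact N₁ N₂ N₃ f g hf hg hfg h₁ h₃ =>
    exact subsingleton_ext_middle (shortExact_shortComplexOfExact hfg hf hg) N h₁ h₃

/-- If the residue field has no `Ext` into `N` above degree `D`, then a finitely generated module
of depth at least `t` has none above degree `D - t`. -/
lemma subsingleton_ext_of_depth (N : ModuleCat.{0} R) [Module.Finite R N] {D : ℕ}
    (h : ∀ i, D < i → Subsingleton (Abelian.Ext (ModuleCat.of R (ResidueField R)) N i)) (t : ℕ)
    (M : ModuleCat.{0} R) [Module.Finite R M]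
    (hM : ∀ i < t, Subsingleton (Abelian.Ext (ModuleCat.of R (ResidueField R)) M i))
    {i : ℕ} (hi : D < i + t) : Subsingleton (Abelian.Ext M N i) := by
  induction t generalizing M i with
  | zero => exact subsingleton_ext_of_residueField N h M inferInstance hi
  | succ t ih =>
    obtain ⟨y, hy, hreg⟩ := exists_isSMulRegular_of_subsingleton_ext M (hM 0 t.succ_pos)
    refine subsingleton_ext_of_isSMulRegular M N hy hreg (ih _ (fun j hj ↦ ?_) (by omega))
    exact subsingleton_ext_right hreg.smulShortComplex_shortExact _ (hM j (by omega))
      (hM (j + 1) (by omega))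

end Local

section FiniteLength

variable {R : Type} [CommRing R] [IsLocalRing R]

lemma nonempty_linearEquiv_residueField (M : Type) [AddCommGroup M] [Module R M]
    [IsSimpleModule R M] : Nonempty (M ≃ₗ[R] ResidueField R) := by
  obtain ⟨I, hI, ⟨e⟩⟩ := isSimpleModule_iff_quot_maximal.mp ‹IsSimpleModule R M›
  obtain rfl := eq_maximalIdeal hI
  exact ⟨e⟩

lemma subsingleton_ext_of_isFiniteLength (N : ModuleCat.{0} R) {i : ℕ}
    (h : Subsingleton (Abelian.Ext (ModuleCat.of R (ResidueField R)) N i))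
    (M : Type) [AddCommGroup M] [Module R M] (hM : IsFiniteLength R M) :
    Subsingleton (Abelian.Ext (ModuleCat.of R M) N i) := by
  induction hM with
  | of_subsingleton => exact subsingleton_ext_of_subsingleton ‹_› N i
  | @of_simple_quotient M _ _ L _ _ ih =>
    obtain ⟨e⟩ := nonempty_linearEquiv_residueField (R := R) (M ⧸ L)
    exact subsingleton_ext_middle (shortExact_shortComplexOfExact
      (LinearMap.exact_subtype_mkQ L) L.subtype_injective L.mkQ_surjective) N ih
      (extCongrLeft e.toModuleIso N i).subsingleton

/-- If the only nonzero `Ext` module of the residue field into `N` has length one, then the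
corresponding `Ext` functor preserves lengths. -/
lemma length_ext_of_isFiniteLength (N : ModuleCat.{0} R) {D : ℕ}
    (h : ∀ i ≠ D, Subsingleton (Abelian.Ext (ModuleCat.of R (ResidueField R)) N i))
    (hD : Module.length R (Abelian.Ext (ModuleCat.of R (ResidueField R)) N D) = 1)
    (M : Type) [AddCommGroup M] [Module R M] (hM : IsFiniteLength R M) :
    Module.length R (Abelian.Ext (ModuleCat.of R M) N D) = Module.length R M := by
  induction hM with
  | of_subsingleton =>
    have := subsingleton_ext_of_subsingleton (R := R) (M := ModuleCat.of R _) ‹_› N D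
    rw [Module.length_eq_zero, Module.length_eq_zero]
  | @of_simple_quotient M _ _ L _ hL ih =>
    obtain ⟨e⟩ := nonempty_linearEquiv_residueField (R := R) (M ⧸ L)
    have hS := shortExact_shortComplexOfExact
      (LinearMap.exact_subtype_mkQ L) L.subtype_injective L.mkQ_surjective
    have := length_ext_middle hS N (i := D)
      ((extCongrLeft e.toModuleIso N (D + 1)).subsingleton_congr.mpr (h _ (by omega)))
      (fun j hj ↦ subsingleton_ext_of_isFiniteLength N (h _ (by omega)) L hL)
    refine this.trans ?_
    rw [Module.length_eq_add_of_exact L.subtype L.mkQ L.subtype_injective L.mkQ_surjective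
      (LinearMap.exact_subtype_mkQ L), Module.length_eq_one R (M ⧸ L)]
    change Module.length R (Abelian.Ext (ModuleCat.of R (M ⧸ L)) N D) +
      Module.length R (Abelian.Ext (ModuleCat.of R L) N D) = _
    rw [ih, (extCongrLeft e.toModuleIso N D).length_eq, hD, add_comm]

variable [IsNoetherianRing R]

omit [IsLocalRing R] in
lemma isFiniteLength_of_supportDim_le_zero (M : Type) [AddCommGroup M] [Module R M]
    [Module.Finite R M] (h : Module.supportDim R M ≤ 0) : IsFiniteLength R M := by
  rw [Module.supportDim_eq_ringKrullDim_quotient_annihilator] at h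
  have : IsArtinianRing (R ⧸ Module.annihilator R M) :=
    isArtinianRing_iff_krullDimLE_zero.mpr (Ring.krullDimLE_iff.mpr h)
  let := Module.quotientAnnihilator (R := R) (M := M)
  have : IsScalarTower R (R ⧸ Module.annihilator R M) M :=
    Module.IsTorsionBySet.isScalarTower (Module.isTorsionBySet_annihilator R M)
  have : Module.Finite (R ⧸ Module.annihilator R M) M :=
    Module.Finite.of_restrictScalars_finite R _ M
  have : IsArtinian (R ⧸ Module.annihilator R M) M := isArtinian_of_fg_of_artinian'
  have : IsArtinian R M := isArtinian_of_surjective_algebraMap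
    (R := R ⧸ Module.annihilator R M) Ideal.Quotient.mk_surjective
  exact isFiniteLength_iff_isNoetherian_isArtinian.mpr ⟨inferInstance, this⟩

omit [IsLocalRing R] in
/-- A module `W` of finite length such that `Hom(-, W)` preserves lengths has no endomorphisms
other than the homotheties. -/
lemma exists_eq_smul_id_of_isFiniteLength (W : ModuleCat.{0} R) [Module.Finite R W]
    (hW : Module.supportDim R W ≤ 0)
    (hlen : ∀ M : ModuleCat.{0} R, IsFiniteLength R M →
      Module.annihilator R W ≤ Module.annihilator R M →
      Module.length R (Abelian.Ext M W 0) = Module.length R M) (f : W →ₗ[R] W) :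
    ∃ r : R, f = r • LinearMap.id := by
  have hfl := isFiniteLength_of_supportDim_le_zero W hW
  set J := Module.annihilator R W with hJ
  have hflJ : IsFiniteLength R (R ⧸ J) := by
    refine isFiniteLength_of_supportDim_le_zero _ ?_
    rwa [Module.supportDim_eq_ringKrullDim_quotient_annihilator, Ideal.annihilator_quotient,
      ← Module.supportDim_eq_ringKrullDim_quotient_annihilator]
  have h1 := hlen W hfl le_rfl
  have h2 := hlen (ModuleCat.of R (R ⧸ J)) hflJ Ideal.annihilator_quotient.ge
  rw [(extZeroLinearEquiv _ _).length_eq] at h1 h2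
  let φ : (R ⧸ J) →ₗ[R] (W →ₗ[R] W) := J.liftQ (LinearMap.toSpanSingleton R _ LinearMap.id) (by
    intro a ha
    ext w
    exact Module.mem_annihilator.mp ha w)
  have hφ : Function.Injective φ := by
    refine LinearMap.ker_eq_bot.mp (Submodule.ker_liftQ_eq_bot _ _ _ fun a ha ↦ ?_)
    refine Module.mem_annihilator.mpr fun w ↦ ?_
    exact congr($ha w)
  let ψ : W →ₗ[R] ((R ⧸ J) →ₗ[R] W) :=
    { toFun w := J.liftQ (LinearMap.toSpanSingleton R _ w) fun a ha ↦
        Module.mem_annihilator.mp ha w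
      map_add' w w' := Submodule.linearMap_qext _ (by ext; exact smul_add 1 w w')
      map_smul' a w := Submodule.linearMap_qext _ (by ext; exact smul_comm 1 a w) }
  have hψ' (w : W) (r : R) : ψ w (J.mkQ r) = r • w := rfl
  have hψi : Function.Injective ψ := fun w w' h ↦ by
    have := congr($h (J.mkQ 1))
    rwa [hψ', hψ', one_smul, one_smul] at this
  have hψs : Function.Surjective ψ := fun g ↦ ⟨g (J.mkQ 1), Submodule.linearMap_qext _ <| by
    ext
    exact (hψ' _ 1).trans (one_smul _ _)⟩
  have h3 : Module.length R W = Module.length R (R ⧸ J) :=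
    (LinearEquiv.ofBijective ψ ⟨hψi, hψs⟩).length_eq.trans h2
  have hE : IsFiniteLength R (W →ₗ[R] W) := by
    rw [← Module.length_ne_top_iff, h1]
    exact Module.length_ne_top_iff.mpr hfl
  obtain ⟨_, _⟩ := isFiniteLength_iff_isNoetherian_isArtinian.mp hE
  have hr : LinearMap.range φ = ⊤ := by
    by_contra hne
    refine (Submodule.length_lt hne).ne ?_
    rw [← (LinearEquiv.ofInjective φ hφ).length_eq, h1, h3]
  obtain ⟨a, rfl⟩ := LinearMap.range_eq_top.mp hr f
  obtain ⟨r, rfl⟩ := J.mkQ_surjective a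
  exact ⟨r, rfl⟩

omit [IsLocalRing R] [IsNoetherianRing R] in
lemma length_ext_quotSMulTop (M W : ModuleCat.{0} R) {y : R} (hreg : IsSMulRegular W y) {t : ℕ}
    (hM : ∀ m : M, y • m = 0) (h : Subsingleton (Abelian.Ext M W t)) :
    Module.length R (Abelian.Ext M (ModuleCat.of R (QuotSMulTop y W)) t) =
      Module.length R (Abelian.Ext M W (t + 1)) := by
  have hS := hreg.smulShortComplex_shortExact
  refine (LinearEquiv.ofBijective (hS.extClass.postcompOfLinear R M rfl) ⟨?_, ?_⟩).length_eq
  · refine (injective_iff_map_eq_zero _).mpr fun e he ↦ ?_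
    obtain ⟨e', rfl⟩ := Abelian.Ext.covariant_sequence_exact₃ M hS e rfl he
    rw [h.elim e' 0]
    exact Abelian.Ext.zero_comp ..
  · intro e
    refine Abelian.Ext.covariant_sequence_exact₁ M hS e ?_ rfl
    have h0 : y • 𝟙 M = 0 := by
      ext m
      exact hM m
    have h1 (e : Abelian.Ext M W (t + 1)) :
        e.comp (Abelian.Ext.mk₀ (y • 𝟙 W)) (add_zero _) = 0 := by
      have h2 : (Abelian.Ext.mk₀ (y • 𝟙 M)).comp e (zero_add _) = 0 := by simp [h0]
      rw [Abelian.Ext.mk₀_smul, Abelian.Ext.smul_comp, Abelian.Ext.mk₀_id_comp] at h2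
      rw [Abelian.Ext.mk₀_smul, Abelian.Ext.comp_smul, Abelian.Ext.comp_mk₀_id, h2]
    exact h1 e

/-- If the functor `Ext^t(-, W)` preserves lengths, where `t` bounds the dimension of `W` and the
lower `Ext` modules of the residue field into `W` vanish, then every endomorphism of `W` is a
homothety. -/
lemma exists_eq_smul_id (t : ℕ) (W : ModuleCat.{0} R) [Module.Finite R W]
    (hW : Module.supportDim R W ≤ t)
    (hext : ∀ i < t, Subsingleton (Abelian.Ext (ModuleCat.of R (ResidueField R)) W i))
    (hlen : ∀ M : ModuleCat.{0} R, IsFiniteLength R M →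
      Module.annihilator R W ≤ Module.annihilator R M →
      Module.length R (Abelian.Ext M W t) = Module.length R M) (f : W →ₗ[R] W) :
    ∃ r : R, f = r • LinearMap.id := by
  induction t generalizing W with
  | zero => exact exists_eq_smul_id_of_isFiniteLength W (by simpa using hW) hlen f
  | succ t ih =>
    obtain ⟨y, hy, hreg⟩ := exists_isSMulRegular_of_subsingleton_ext W (hext 0 t.succ_pos)
    have hS := hreg.smulShortComplex_shortExact
    have hyann : ∀ w : QuotSMulTop y W, y • w = 0 := fun w ↦ by
      obtain ⟨w, rfl⟩ := Submodule.mkQ_surjective _ w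
      rw [← map_smul]
      exact (Submodule.Quotient.mk_eq_zero _).mpr (Submodule.smul_mem_pointwise_smul w y ⊤ trivial)
    have key (g : QuotSMulTop y W →ₗ[R] QuotSMulTop y W) : ∃ r : R, g = r • LinearMap.id := by
      refine ih (ModuleCat.of R (QuotSMulTop y W)) ?_ (fun i hi ↦ ?_) (fun M hM hann ↦ ?_) g
      · have := Module.supportDim_quotSMulTop_succ_eq_supportDim hreg hy
        rw [← this, Nat.cast_add, Nat.cast_one] at hW
        exact (ENat.WithBot.add_le_add_one_right_iff).mp hW
      · exact subsingleton_ext_right hS _ (hext i (by omega)) (hext (i + 1) (by omega))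
      · rw [length_ext_quotSMulTop M W hreg
          (fun m ↦ Module.mem_annihilator.mp (hann (Module.mem_annihilator.mpr hyann)) m)
          (subsingleton_ext_of_isFiniteLength W (hext t (by omega)) M hM)]
        refine hlen M hM (le_trans ?_ hann)
        exact (Submodule.mkQ (y • (⊤ : Submodule R W))).annihilator_le_of_surjective
          (Submodule.mkQ_surjective _)
    have hlift (f : W →ₗ[R] W) : ∃ (r : R) (g : W →ₗ[R] W), f = r • LinearMap.id + y • g := by
      obtain ⟨r, hr⟩ := key ((y • (⊤ : Submodule R W)).mapQ (y • (⊤ : Submodule R W)) f fun w hw ↦ by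
        obtain ⟨w, -, rfl⟩ := hw
        exact ⟨f w, trivial, (map_smul f y w).symm⟩)
      have hmem (w : W) : ∃ v : W, y • v = f w - r • w := by
        have := congr($hr (Submodule.mkQ _ w))
        have h2 : f w - r • w ∈ y • (⊤ : Submodule R W) := (Submodule.Quotient.eq _).mp this
        obtain ⟨v, -, hv⟩ := h2
        exact ⟨v, hv⟩
      choose g hg using hmem
      refine ⟨r, ⟨⟨g, fun a b ↦ hreg ?_⟩, fun a b ↦ hreg ?_⟩, ?_⟩
      · simp only [smul_add, hg, map_add]
        abel
      · simp only [hg, RingHom.id_apply, smul_comm y a, map_smul, smul_sub, smul_comm a r]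
      · ext w
        simp [hg]
    have : Subsingleton ((W →ₗ[R] W) ⧸ Submodule.span R {(LinearMap.id : W →ₗ[R] W)}) := by
      refine subsingleton_of_forall_exists_smul_eq hy fun e ↦ ?_
      obtain ⟨f, rfl⟩ := Submodule.mkQ_surjective _ e
      obtain ⟨r, g, rfl⟩ := hlift f
      refine ⟨Submodule.mkQ _ g, ?_⟩
      have h0 : Submodule.mkQ (Submodule.span R {(LinearMap.id : W →ₗ[R] W)})
          (r • LinearMap.id) = 0 :=
        (Submodule.Quotient.mk_eq_zero _).mpr
          (Submodule.smul_mem _ r (Submodule.mem_span_singleton_self _))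
      rw [map_add, h0, zero_add, map_smul]
    have hf : f ∈ Submodule.span R {(LinearMap.id : W →ₗ[R] W)} :=
      (Submodule.Quotient.mk_eq_zero _).mp (Subsingleton.elim _ _)
    obtain ⟨r, hr⟩ := Submodule.mem_span_singleton.mp hf
    exact ⟨r, hr.symm⟩

end FiniteLength

section Depth

variable {R : Type} [CommRing R]

lemma HasFiniteInjDim.congr {M N : ModuleCat.{0} R} (e : M ≅ N) (h : HasFiniteInjDim R M) :
    HasFiniteInjDim R N := by
  obtain ⟨n, hn⟩ := h
  exact ⟨n, fun L i hi ↦ ((((Ext R (ModuleCat R) i).obj (Opposite.op L)).mapIso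
    e).toLinearEquiv.subsingleton_congr).mp (hn L i hi)⟩

variable [IsLocalRing R]

lemma subsingleton_ext_of_lt_moduleDepth {M : ModuleCat.{0} R} {i : ℕ}
    (hi : (i : ℕ∞) < moduleDepth R M) :
    Subsingleton (Abelian.Ext (ModuleCat.of R (ResidueField R)) M i) := by
  rw [← (modExtLinearEquiv R i _ M).subsingleton_congr, ← not_nontrivial_iff_subsingleton]
  intro h
  exact notMem_of_lt_csInf' hi ⟨i, rfl, h⟩

lemma le_moduleDepth {M : ModuleCat.{0} R} {n : ℕ}
    (h : ∀ i < n, Subsingleton (Abelian.Ext (ModuleCat.of R (ResidueField R)) M i)) :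
    (n : ℕ∞) ≤ moduleDepth R M := by
  refine le_sInf ?_
  rintro _ ⟨m, rfl, hm⟩
  by_contra! hlt
  have := h m (by exact_mod_cast hlt)
  rw [← (modExtLinearEquiv R m _ M).subsingleton_congr] at this
  exact not_subsingleton _ this

variable [IsNoetherianRing R]

lemma le_supportDim_of_subsingleton_ext (n : ℕ) (M : ModuleCat.{0} R) [Module.Finite R M]
    [Nontrivial M]
    (hM : ∀ i < n, Subsingleton (Abelian.Ext (ModuleCat.of R (ResidueField R)) M i)) :
    n ≤ Module.supportDim R M := by
  induction n generalizing M with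
  | zero =>
    have : Nonempty (Module.support R M) := Module.nonempty_support_of_nontrivial.to_subtype
    exact Order.krullDim_nonneg
  | succ n ih =>
    obtain ⟨y, hy, hreg⟩ := exists_isSMulRegular_of_subsingleton_ext M (hM 0 n.succ_pos)
    rw [← Module.supportDim_quotSMulTop_succ_eq_supportDim hreg hy, Nat.cast_add, Nat.cast_one]
    have : Nontrivial (QuotSMulTop y M) := by
      rw [← not_subsingleton_iff_nontrivial]
      intro h
      have := subsingleton_of_forall_exists_smul_eq hy fun m : M ↦ by
        obtain ⟨m', -, h'⟩ : m ∈ y • (⊤ : Submodule R M) :=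
          (Submodule.Quotient.mk_eq_zero _).mp (Subsingleton.elim _ _)
        exact ⟨m', h'⟩
      exact not_subsingleton M this
    refine (ENat.WithBot.add_le_add_one_right_iff).mpr
      (ih (ModuleCat.of R (QuotSMulTop y M)) fun i hi ↦ ?_)
    exact subsingleton_ext_right hreg.smulShortComplex_shortExact _ (hM i (by omega))
      (hM (i + 1) (by omega))

/-- Over a local ring of dimension `d + 1`, a nonzero finitely generated module of depth at least
`d` killed by a nonzerodivisor is Cohen-Macaulay of codimension one. -/
lemma isCMofCodimOne_of_smul_eq_zero (M : ModuleCat.{0} R) [Module.Finite R M] [Nontrivial M]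
    {x : R} (hx : x ∈ nonZeroDivisors R) (hxm : x ∈ maximalIdeal R) (hxM : ∀ m : M, x • m = 0)
    {d : ℕ} (hd : ringKrullDim R = (d + 1 : ℕ))
    (hM : ∀ i < d, Subsingleton (Abelian.Ext (ModuleCat.of R (ResidueField R)) M i)) :
    IsCMofCodimOne R M := by
  have hle : Module.supportDim R M ≤ d := by
    rw [Module.supportDim_eq_ringKrullDim_quotient_annihilator]
    have h1 : Ideal.span {x} ≤ Module.annihilator R M :=
      (Ideal.span_singleton_le_iff_mem _).mpr (Module.mem_annihilator.mpr hxM)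
    refine (ringKrullDim_le_of_surjective _ (Ideal.Quotient.factor_surjective h1)).trans ?_
    rw [← ENat.WithBot.add_le_add_one_right_iff,
      ringKrullDim_quotient_span_singleton_succ_eq_ringKrullDim_of_mem_nonZeroDivisors hx hxm, hd]
    rfl
  refine ⟨‹_›, d, hd, le_antisymm ?_ (le_moduleDepth hM), ?_⟩
  · by_contra! hlt
    have h1 : ((d + 1 : ℕ) : WithBot ℕ∞) ≤ Module.supportDim R M :=
      le_supportDim_of_subsingleton_ext (d + 1) M fun i hi ↦
        subsingleton_ext_of_lt_moduleDepth
          (lt_of_le_of_lt (by exact_mod_cast Nat.le_of_lt_succ hi) hlt)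
    have h2 : (d + 1 : ℕ) ≤ d := by exact_mod_cast h1.trans hle
    omega
  · rw [← Module.supportDim_eq_ringKrullDim_quotient_annihilator]
    exact le_antisymm hle (le_supportDim_of_subsingleton_ext d M hM)

end Depth

section Canonical

variable {R : Type} [CommRing R] {ω : Ideal R} {x : R}

/-- Multiplication by an element of an ideal, as a map into that ideal. -/
abbrev mulToIdeal (hxω : x ∈ ω) : R →ₗ[R] ω :=
  LinearMap.toSpanSingleton R ω ⟨x, hxω⟩

lemma mulToIdeal_injective (hxω : x ∈ ω) (hx : x ∈ nonZeroDivisors R) :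
    Function.Injective (mulToIdeal hxω) := by
  refine (injective_iff_map_eq_zero _).mpr fun r hr ↦ ?_
  exact (mem_nonZeroDivisors_iff_right.mp hx) r congr(($hr).1)

lemma exact_mulToIdeal_mkQ (hxω : x ∈ ω) :
    Function.Exact (mulToIdeal hxω) (Submodule.comap ω.subtype (Ideal.span {x})).mkQ := by
  intro w
  rw [Submodule.mkQ_apply, Submodule.Quotient.mk_eq_zero, Submodule.mem_comap,
    Ideal.mem_span_singleton']
  simp [Subtype.ext_iff]

lemma exact_lsmul_mkQ (x : R) (ω : Ideal R) :
    Function.Exact (LinearMap.lsmul R ω x)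
      (Submodule.comap ω.subtype (Ideal.span {x} * ω)).mkQ := by
  intro w
  rw [Submodule.mkQ_apply, Submodule.Quotient.mk_eq_zero, Submodule.mem_comap,
    Ideal.mem_span_singleton_mul]
  simp [Subtype.ext_iff]

lemma exact_subtype_mkQ_comp_mulToIdeal (hx : x ∈ nonZeroDivisors R) (ω : Ideal R) :
    Function.Exact ω.subtype ((Submodule.comap (Ideal.span {x}).subtype
      (Ideal.span {x} * ω)).mkQ ∘ₗ mulToIdeal (Ideal.mem_span_singleton_self x)) := by
  intro r
  rw [LinearMap.comp_apply, Submodule.mkQ_apply, Submodule.Quotient.mk_eq_zero,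
    Submodule.mem_comap, Ideal.mem_span_singleton_mul]
  constructor
  · rintro ⟨z, hz, h⟩
    have : x * z = x * r := h.trans (mul_comm r x)
    exact ⟨⟨z, hz⟩, (mul_cancel_left_mem_nonZeroDivisors hx).mp this⟩
  · rintro ⟨z, rfl⟩
    exact ⟨z, z.2, mul_comm x z.1⟩

lemma nontrivial_qmod {I J : Ideal R} (h : ¬ I ≤ J) : Nontrivial (qmod R I J) :=
  Submodule.Quotient.nontrivial_iff.mpr fun h' ↦ h fun w hw ↦
    (h'.ge (Submodule.mem_top (x := (⟨w, hw⟩ : I))) :)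

lemma smul_qmod_eq_zero {I J : Ideal R} (h : Ideal.span {x} * I ≤ J) (m : qmod R I J) :
    x • m = 0 := by
  obtain ⟨w, rfl⟩ := Submodule.mkQ_surjective _ m
  rw [← map_smul]
  exact (Submodule.Quotient.mk_eq_zero _).mpr
    (h (Ideal.mul_mem_mul (Ideal.mem_span_singleton_self x) w.2))

lemma mulToIdeal_span_surjective (x : R) :
    Function.Surjective (mulToIdeal (Ideal.mem_span_singleton_self x)) := by
  rintro ⟨w, hw⟩
  obtain ⟨r, rfl⟩ := Ideal.mem_span_singleton'.mp hw
  exact ⟨r, rfl⟩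

variable [IsLocalRing R] [IsNoetherianRing R]

lemma not_le_span_singleton_of_isCanonicalIdeal (hω : IsCanonicalIdeal R ω)
    (hnG : ¬ IsGorensteinLocalRing R) (hxω : x ∈ ω) (hx : x ∈ nonZeroDivisors R) :
    ¬ ω ≤ Ideal.span {x} := by
  intro h
  have hs : Function.Surjective (mulToIdeal hxω) := fun w ↦ by
    obtain ⟨r, hr⟩ := Ideal.mem_span_singleton'.mp (h w.2)
    exact ⟨r, Subtype.ext hr⟩
  exact hnG ⟨inferInstance, inferInstance, HasFiniteInjDim.congr
    (LinearEquiv.ofBijective _ ⟨mulToIdeal_injective hxω hx, hs⟩).toModuleIso.symm hω.2.1⟩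

variable {d : ℕ} (hext : ∀ i ≠ d,
    Subsingleton (Abelian.Ext (ModuleCat.of R (ResidueField R)) (ModuleCat.of R ω) i))
  (hlen : Module.length R
    (Abelian.Ext (ModuleCat.of R (ResidueField R)) (ModuleCat.of R ω) d) = 1)

include hext in
/-- The connecting map `Hom(R, ω) → Ext¹(ω/xR, ω)` is surjective, and the kernel of the induced map
on `ω` is `xR` as soon as all endomorphisms of `ω` are homotheties. -/
lemma exists_linearMap_ext_one (hxω : x ∈ ω) (hx : x ∈ nonZeroDivisors R)
    (hend : ∀ f : ω →ₗ[R] ω, ∃ r : R, f = r • LinearMap.id) :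
    ∃ Δ : ω →ₗ[R] Abelian.Ext (qmod R ω (Ideal.span {x})) (ModuleCat.of R ω) 1,
      Function.Surjective Δ ∧
      LinearMap.ker Δ = Submodule.comap ω.subtype (Ideal.span {x}) := by
  have hS := shortExact_shortComplexOfExact (exact_mulToIdeal_mkQ hxω)
    (mulToIdeal_injective hxω hx) (Submodule.mkQ_surjective _)
  have h1 : Subsingleton (Abelian.Ext (ModuleCat.of R ω) (ModuleCat.of R ω) 1) :=
    subsingleton_ext_of_depth _ (fun i hi ↦ hext i hi.ne') d _ (fun i hi ↦ hext i hi.ne)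
      (by omega)
  let ev : ω ≃ₗ[R] Abelian.Ext (ModuleCat.of R R) (ModuleCat.of R ω) 0 :=
    (LinearMap.ringLmapEquivSelf R R ω).symm.trans
      (extZeroLinearEquiv (ModuleCat.of R R) (ModuleCat.of R ω)).symm
  have hev (w : ω) : ev w =
    Abelian.Ext.mk₀ (ModuleCat.ofHom (LinearMap.toSpanSingleton R ω w)) := rfl
  let δ : Abelian.Ext (ModuleCat.of R R) (ModuleCat.of R ω) 0 →ₗ[R]
      Abelian.Ext (qmod R ω (Ideal.span {x})) (ModuleCat.of R ω) 1 :=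
    hS.extClass.precompOfLinear R (ModuleCat.of R ω) (add_zero 1)
  refine ⟨δ ∘ₗ ev.toLinearMap, ?_, ?_⟩
  · rw [LinearMap.coe_comp]
    refine Function.Surjective.comp (g := δ) (fun e ↦ ?_) ev.surjective
    exact Abelian.Ext.contravariant_sequence_exact₃ hS _ e (h1.elim _ _) (add_zero 1)
  · ext w
    rw [LinearMap.mem_ker, Submodule.mem_comap, Ideal.mem_span_singleton']
    constructor
    · intro hw
      obtain ⟨φ, hφ⟩ := Abelian.Ext.contravariant_sequence_exact₁ hS (ModuleCat.of R ω) (ev w)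
        (add_zero 1) hw
      obtain ⟨g, rfl⟩ := Abelian.Ext.addEquiv₀.symm.surjective φ
      obtain ⟨r, hr⟩ := hend g.hom
      rw [hev] at hφ
      have h2 := (Abelian.Ext.mk₀_comp_mk₀ _ _).symm.trans hφ
      have h3 := congr(($((Abelian.Ext.mk₀_bijective _ _).injective h2)).hom (1 : R))
      refine ⟨r, ?_⟩
      have h4 : g.hom ((1 : R) • ⟨x, hxω⟩) = (1 : R) • w := h3
      rw [one_smul, one_smul, hr] at h4
      exact congr(($h4).1)
    · rintro ⟨r, hr⟩
      obtain rfl : w = r • ⟨x, hxω⟩ := Subtype.ext hr.symm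
      rw [map_smul]
      refine smul_eq_zero_of_right r ?_
      exact hS.extClass_comp

include hext hlen in
lemma exists_eq_smul_id_of_ext (hd : ringKrullDim R = d) (f : ω →ₗ[R] ω) :
    ∃ r : R, f = r • LinearMap.id :=
  exists_eq_smul_id d (ModuleCat.of R ω) (hd ▸ Module.supportDim_le_ringKrullDim R ω)
    (fun i hi ↦ hext i hi.ne)
    (fun M hM _ ↦ length_ext_of_isFiniteLength (ModuleCat.of R ω) hext hlen M hM) f

end Canonical

theorem stmt10 (R : Type) [CommRing R] [IsLocalRing R]
    (hCM : IsCMLocalRing R) (hGG : IsGenericallyGorenstein R)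
    (hnG : ¬ IsGorensteinLocalRing R)
    (ω : Ideal R) (hω : IsCanonicalIdeal R ω)
    (x : R) (hxω : x ∈ ω) (hxreg : x ∈ nonZeroDivisors R) :
    IsCMofCodimOne R (qmod R (Ideal.span {x}) (Ideal.span {x} * ω)) ∧
    IsCMofCodimOne R (qmod R ω (Ideal.span {x} * ω)) ∧
    IsCMofCodimOne R (qmod R ω (Ideal.span {x})) ∧
    ∃ f : (ModExt R 1 (qmod R ω (Ideal.span {x})) (ModuleCat.of R ↥ω)) →ₗ[R] (R ⧸ Ideal.span {x}),
      Function.Injective f ∧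
      Function.Exact f
        (Submodule.mapQ (Ideal.span {x}) ω LinearMap.id
          (by simpa using Ideal.span_le.mpr (Set.singleton_subset_iff.mpr hxω))) ∧
      Function.Surjective
        (Submodule.mapQ (Ideal.span {x}) ω LinearMap.id
          (by simpa using Ideal.span_le.mpr (Set.singleton_subset_iff.mpr hxω))) := by
  obtain ⟨hN, hdepth⟩ := hCM
  have hxr : ¬ ω ≤ Ideal.span {x} := not_le_span_singleton_of_isCanonicalIdeal hω hnG hxω hxreg
  have hω1 : (1 : R) ∉ ω := fun h1 ↦ by
    exact not_le_span_singleton_of_isCanonicalIdeal hω hnG h1 (one_mem _) (by simp)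
  obtain ⟨-, -, D, hD, ⟨e⟩, hext'⟩ := hω
  have hext (i : ℕ) (hi : i ≠ D) :
      Subsingleton (Abelian.Ext (ModuleCat.of R (ResidueField R)) (ModuleCat.of R ω) i) :=
    (modExtLinearEquiv R i _ _).subsingleton_congr.mp (hext' i hi)
  have hlen : Module.length R
      (Abelian.Ext (ModuleCat.of R (ResidueField R)) (ModuleCat.of R ω) D) = 1 := by
    have : IsSimpleModule R (ResidueField R) :=
      isSimpleModule_iff_quot_maximal.mpr ⟨_, maximalIdeal.isMaximal R, ⟨.refl R _⟩⟩
    rw [← (modExtLinearEquiv R D _ _).length_eq, e.length_eq, Module.length_eq_one]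
  have hxm : x ∈ maximalIdeal R :=
    le_maximalIdeal ((Ideal.ne_top_iff_one ω).mpr hω1) hxω
  obtain ⟨d, rfl⟩ : ∃ d, D = d + 1 := by
    refine Nat.exists_eq_succ_of_ne_zero ?_
    rintro rfl
    have h1 := ringKrullDim_quotient_span_singleton_succ_eq_ringKrullDim_of_mem_nonZeroDivisors
      hxreg hxm
    have : Nontrivial (R ⧸ Ideal.span {x}) := Submodule.Quotient.nontrivial_iff.mpr fun h ↦
      hxr (h ▸ le_top)
    have h2 : (0 : WithBot ℕ∞) ≤ ringKrullDim (R ⧸ Ideal.span {x}) :=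
      ringKrullDim_nonneg_of_nontrivial
    rw [hD, Nat.cast_zero] at h1
    exact absurd (h1 ▸ add_le_add_left h2 1 : (0 + 1 : WithBot ℕ∞) ≤ 0) (by decide)
  have hR (i : ℕ) (hi : i < d + 1) :
      Subsingleton (Abelian.Ext (ModuleCat.of R (ResidueField R)) (ModuleCat.of R R) i) := by
    refine subsingleton_ext_of_lt_moduleDepth ?_
    rw [hD] at hdepth
    rw [(by exact_mod_cast hdepth : moduleDepth R (ModuleCat.of R R) = (d + 1 : ℕ))]
    exact_mod_cast hi
  refine ⟨?_, ?_, ?_, ?_⟩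
  · have : Nontrivial (qmod R (Ideal.span {x}) (Ideal.span {x} * ω)) := by
      refine nontrivial_qmod fun h ↦ hω1 ?_
      obtain ⟨z, hz, h⟩ := Ideal.mem_span_singleton_mul.mp (h (Ideal.mem_span_singleton_self x))
      rwa [(mul_cancel_left_mem_nonZeroDivisors hxreg).mp (h.trans (mul_one x).symm)] at hz
    refine isCMofCodimOne_of_smul_eq_zero _ hxreg hxm (smul_qmod_eq_zero ?_) hD fun i hi ↦ ?_
    · exact Ideal.mul_mono_right ((Ideal.span_singleton_le_iff_mem _).mpr hxω)
    · refine subsingleton_ext_right (shortExact_shortComplexOfExact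
        (exact_subtype_mkQ_comp_mulToIdeal hxreg ω) ω.subtype_injective ?_) _
        (hR i (by omega)) (hext (i + 1) (by omega))
      exact (Submodule.mkQ_surjective _).comp (mulToIdeal_span_surjective x)
  · have : Nontrivial (qmod R ω (Ideal.span {x} * ω)) :=
      nontrivial_qmod fun h ↦ hxr (h.trans Ideal.mul_le_left)
    refine isCMofCodimOne_of_smul_eq_zero _ hxreg hxm (smul_qmod_eq_zero le_rfl) hD fun i hi ↦ ?_
    refine subsingleton_ext_right (shortExact_shortComplexOfExact (exact_lsmul_mkQ x ω) ?_
      (Submodule.mkQ_surjective _)) _ (hext i (by omega)) (hext (i + 1) (by omega))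
    intro a b hab
    exact Subtype.ext ((mul_cancel_left_mem_nonZeroDivisors hxreg).mp congr(($hab).1))
  · have := nontrivial_qmod hxr
    refine isCMofCodimOne_of_smul_eq_zero _ hxreg hxm (smul_qmod_eq_zero Ideal.mul_le_left) hD
      fun i hi ↦ ?_
    exact subsingleton_ext_right (shortExact_shortComplexOfExact (exact_mulToIdeal_mkQ hxω)
      (mulToIdeal_injective hxω hxreg) (Submodule.mkQ_surjective _)) _ (hext i (by omega))
      (hR (i + 1) (by omega))
  · obtain ⟨Δ, hΔ, hker⟩ := exists_linearMap_ext_one hext hxω hxreg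
      (exists_eq_smul_id_of_ext hext hlen hD)
    let ε : ModExt R 1 (qmod R ω (Ideal.span {x})) (ModuleCat.of R ω) ≃ₗ[R]
        ω ⧸ Submodule.comap ω.subtype (Ideal.span {x}) :=
      (modExtLinearEquiv R 1 _ _).trans
        ((Δ.quotKerEquivOfSurjective hΔ).symm.trans (Submodule.quotEquivOfEq _ _ hker))
    let j : (ω ⧸ Submodule.comap ω.subtype (Ideal.span {x})) →ₗ[R] R ⧸ Ideal.span {x} :=
      Submodule.mapQ _ _ ω.subtype le_rfl
    refine ⟨j ∘ₗ ε.toLinearMap, ?_, ?_, ?_⟩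
    · refine Function.Injective.comp (g := j) (LinearMap.ker_eq_bot.mp ?_) ε.injective
      exact Submodule.ker_liftQ_eq_bot _ _ _ fun w hw ↦
        (Submodule.Quotient.mk_eq_zero (Ideal.span {x})).mp hw
    · intro a
      obtain ⟨r, rfl⟩ := Submodule.mkQ_surjective _ a
      constructor
      · intro hr
        have hr' : r ∈ ω := (Submodule.Quotient.mk_eq_zero _).mp hr
        obtain ⟨c, hc⟩ := ε.surjective (Submodule.mkQ _ ⟨r, hr'⟩)
        refine ⟨c, ?_⟩
        exact congr(j $hc)
      · rintro ⟨c, hc⟩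
        rw [← hc]
        change Submodule.mapQ _ _ _ _ (j (ε c)) = 0
        obtain ⟨w, hw⟩ := Submodule.mkQ_surjective _ (ε c)
        rw [← hw]
        exact (Submodule.Quotient.mk_eq_zero _).mpr w.2
    · intro a
      obtain ⟨r, rfl⟩ := Submodule.mkQ_surjective _ a
      exact ⟨Submodule.mkQ _ r, rfl⟩

end
end

section
/- Let (R,𝔪) be a Cohen-Macaulay local ring with canonical module that is generically Gorenstein and not Gorenstein, let ω be a canonical ideal of R, let x ∈ ω be an R-regular element, and set (ω/xR)^∨ := Ext^1_R(ω/xR, ω). Then there is a short exact sequence 0 → ω → R ⊕ (ω/xR)^∨ → R/xR → 0 of R-modules. -/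
open CategoryTheory

noncomputable section

/-- A cocycle of degree zero has trivial class in `Ext` only if it vanishes. -/
lemma CategoryTheory.ProjectiveResolution.extMk_zero_degree_eq_zero_iff
    {C : Type*} [Category* C] [Abelian C] [HasExt C] {X Y : C} (P : ProjectiveResolution X)
    (f : P.complex.X 0 ⟶ Y) (hf : P.complex.d 1 0 ≫ f = 0) :
    P.extMk f 1 rfl hf = 0 ↔ f = 0 := by
  refine ⟨fun h ↦ ?_, ?_⟩
  · rw [← P.extEquivCohomologyClass.apply_eq_iff_eq, P.extEquivCohomologyClass_extMk,
      P.extEquivCohomologyClass_zero,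
      CochainComplex.HomComplex.CohomologyClass.mk_eq_zero_iff,
      CochainComplex.HomComplex.Cocycle.toSingleMk_mem_coboundaries_iff _ _ _ _ _ 1
        (by simp)] at h
    obtain ⟨g, hg⟩ := h
    rw [(P.cochainComplex.isZero_of_isStrictlyLE 0 1).eq_of_src g 0, Limits.comp_zero] at hg
    rw [← cancel_epi (P.cochainComplexXIso (-((0 : ℕ) : ℤ)) 0 rfl).hom, ← hg, Limits.comp_zero]
  · rintro rfl
    exact P.extMk_zero 1 rfl

namespace ModuleCat

open Abelian

variable {R : Type} [CommRing R]

/-- A projective resolution computes `Abelian.Ext` as a quotient of the module of cocycles. -/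
lemma exists_cocycles_to_ext {X Y : ModuleCat.{0} R} (P : ProjectiveResolution X) (n : ℕ) :
    ∃ φ : LinearMap.ker ((P.complex.linearYonedaObj R Y).sc n).g.hom →ₗ[R] Abelian.Ext X Y n,
      Function.Surjective φ ∧
        LinearMap.ker φ = LinearMap.range ((P.complex.linearYonedaObj R Y).sc n).moduleCatToCycles := by
  have cocycle (f : P.complex.X n ⟶ Y) :
      P.complex.d (n + 1) n ≫ f = 0 ↔
        f ∈ LinearMap.ker ((P.complex.linearYonedaObj R Y).sc n).g.hom := by
    refine Iff.trans ?_ (LinearMap.mem_ker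
      (f := ((P.complex.linearYonedaObj R Y).sc n).g.hom)).symm
    change _ ↔ P.complex.d ((ComplexShape.up ℕ).next n) n ≫ f = 0
    rw [show (ComplexShape.up ℕ).next n = n + 1 by simp]
  refine ⟨{ toFun f := P.extMk (show P.complex.X n ⟶ Y from f.1) (n + 1) rfl ((cocycle _).2 f.2)
            map_add' f g := (P.add_extMk _ _ _ _ _ _).symm
            map_smul' r f := ?_ }, ?_, ?_⟩
  · rw [RingHom.id_apply, Ext.smul_eq_comp_mk₀, P.extMk_comp_mk₀]
    congr 1
  · intro α
    obtain ⟨f, hf, rfl⟩ := P.extMk_surjective α (n + 1) rfl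
    exact ⟨⟨f, (cocycle f).1 hf⟩, rfl⟩
  · ext f
    rw [LinearMap.mem_ker, LinearMap.mem_range]
    change P.extMk (show P.complex.X n ⟶ Y from f.1) (n + 1) rfl ((cocycle _).2 f.2) = 0 ↔ _
    have coboundary : (∃ y, ((P.complex.linearYonedaObj R Y).sc n).moduleCatToCycles y = f) ↔
        ∃ g : P.complex.X ((ComplexShape.up ℕ).prev n) ⟶ Y,
          P.complex.d n ((ComplexShape.up ℕ).prev n) ≫ g = (show P.complex.X n ⟶ Y from f.1) :=
      exists_congr fun y ↦ Subtype.ext_iff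
    rw [coboundary]
    rcases n with _ | p
    · rw [CochainComplex.prev_nat_zero, P.complex.shape 0 0 (by simp)]
      simp only [Limits.zero_comp, exists_const]
      exact (P.extMk_zero_degree_eq_zero_iff _ _).trans eq_comm
    · rw [CochainComplex.prev_nat_succ]
      exact P.extMk_eq_zero_iff _ _ _ _ p rfl

/-- `Ext` defined by left deriving `Hom` agrees with `Abelian.Ext`. -/
lemma nonempty_modExt_linearEquiv (X Y : ModuleCat.{0} R) (n : ℕ) :
    Nonempty (ModExt R n X Y ≃ₗ[R] Abelian.Ext X Y n) := by
  let P := CategoryTheory.projectiveResolution X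
  obtain ⟨φ, hφ, hker⟩ := exists_cocycles_to_ext (Y := Y) P n
  let S := (P.complex.linearYonedaObj R Y).sc n
  exact ⟨(P.isoExt (R := R) n Y).toLinearEquiv ≪≫ₗ S.moduleCatHomologyIso.toLinearEquiv ≪≫ₗ
    Submodule.quotEquivOfEq _ _ hker.symm ≪≫ₗ φ.quotKerEquivOfSurjective hφ⟩

end ModuleCat

namespace CategoryTheory.ShortComplex.ShortExact

open Abelian

variable {C : Type*} [Category* C] [Abelian C] [HasExt C] {S : ShortComplex C}

lemma subsingleton_ext_X₁_contravariant (hS : S.ShortExact) (W : C) (n : ℕ)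
    (h₂ : Subsingleton (Abelian.Ext S.X₂ W n)) (h₃ : Subsingleton (Abelian.Ext S.X₃ W (n + 1))) :
    Subsingleton (Abelian.Ext S.X₁ W n) := by
  refine subsingleton_of_forall_eq 0 fun e ↦ ?_
  obtain ⟨e', rfl⟩ := Ext.contravariant_sequence_exact₁ hS W e (add_comm 1 n)
    (Subsingleton.elim _ _)
  rw [Subsingleton.elim e' 0, Ext.comp_zero]

lemma subsingleton_ext_X₂_contravariant (hS : S.ShortExact) (W : C) (n : ℕ)
    (h₁ : Subsingleton (Abelian.Ext S.X₁ W n)) (h₃ : Subsingleton (Abelian.Ext S.X₃ W n)) :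
    Subsingleton (Abelian.Ext S.X₂ W n) := by
  refine subsingleton_of_forall_eq 0 fun e ↦ ?_
  obtain ⟨e', rfl⟩ := Ext.contravariant_sequence_exact₂ hS W e (Subsingleton.elim _ _)
  rw [Subsingleton.elim e' 0, Ext.comp_zero]

lemma subsingleton_ext_X₃_contravariant (hS : S.ShortExact) (W : C) (n : ℕ)
    (h₁ : Subsingleton (Abelian.Ext S.X₁ W n)) (h₂ : Subsingleton (Abelian.Ext S.X₂ W (n + 1))) :
    Subsingleton (Abelian.Ext S.X₃ W (n + 1)) := by
  refine subsingleton_of_forall_eq 0 fun e ↦ ?_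
  obtain ⟨e', rfl⟩ := Ext.contravariant_sequence_exact₃ hS W e (Subsingleton.elim _ _)
    (add_comm 1 n)
  rw [Subsingleton.elim e' 0, Ext.comp_zero]

lemma subsingleton_ext_X₃_contravariant_zero (hS : S.ShortExact) (W : C)
    (h₂ : Subsingleton (Abelian.Ext S.X₂ W 0)) : Subsingleton (Abelian.Ext S.X₃ W 0) := by
  have := hS.epi_g
  have h₂' : Subsingleton (S.X₂ ⟶ W) := Ext.addEquiv₀.symm.subsingleton
  have h₃ : Subsingleton (S.X₃ ⟶ W) :=
    ⟨fun a b ↦ by rw [← cancel_epi S.g]; exact Subsingleton.elim _ _⟩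
  exact Ext.addEquiv₀.subsingleton

lemma subsingleton_ext_X₁_covariant_zero (hS : S.ShortExact) (k : C)
    (h₂ : Subsingleton (Abelian.Ext k S.X₂ 0)) : Subsingleton (Abelian.Ext k S.X₁ 0) := by
  have := hS.mono_f
  have h₂' : Subsingleton (k ⟶ S.X₂) := Ext.addEquiv₀.symm.subsingleton
  have h₁ : Subsingleton (k ⟶ S.X₁) :=
    ⟨fun a b ↦ by rw [← cancel_mono S.f]; exact Subsingleton.elim _ _⟩
  exact Ext.addEquiv₀.subsingleton

lemma subsingleton_ext_X₁_covariant (hS : S.ShortExact) (k : C) (n : ℕ)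
    (h₂ : Subsingleton (Abelian.Ext k S.X₂ (n + 1))) (h₃ : Subsingleton (Abelian.Ext k S.X₃ n)) :
    Subsingleton (Abelian.Ext k S.X₁ (n + 1)) := by
  refine subsingleton_of_forall_eq 0 fun e ↦ ?_
  obtain ⟨e', rfl⟩ := Ext.covariant_sequence_exact₁ k hS e (Subsingleton.elim _ _) rfl
  rw [Subsingleton.elim e' 0, Ext.zero_comp]

lemma subsingleton_ext_X₃_covariant (hS : S.ShortExact) (k : C) (n : ℕ)
    (h₁ : Subsingleton (Abelian.Ext k S.X₁ (n + 1))) (h₂ : Subsingleton (Abelian.Ext k S.X₂ n)) :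
    Subsingleton (Abelian.Ext k S.X₃ n) := by
  refine subsingleton_of_forall_eq 0 fun e ↦ ?_
  obtain ⟨e', rfl⟩ := Ext.covariant_sequence_exact₃ k hS e rfl (Subsingleton.elim _ _)
  rw [Subsingleton.elim e' 0, Ext.zero_comp]

end CategoryTheory.ShortComplex.ShortExact

namespace ModuleCat

open Abelian

variable {R : Type} [CommRing R]

lemma subsingleton_ext_of_iso {C : Type*} [Category* C] [Abelian C] [HasExt C] {X X' W : C}
    (e : X ≅ X') (n : ℕ) (h : Subsingleton (Abelian.Ext X W n)) :
    Subsingleton (Abelian.Ext X' W n) := by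
  refine subsingleton_of_forall_eq 0 fun a ↦ ?_
  rw [← Ext.mk₀_id_comp a, ← e.inv_hom_id, ← Ext.mk₀_comp_mk₀, Ext.comp_assoc_of_second_deg_zero,
    Subsingleton.elim ((Ext.mk₀ e.hom).comp a _) 0, Ext.comp_zero]

/-- A short exact sequence of modules, from linear maps. -/
lemma shortExact_of_function_exact {M₁ M₂ M₃ : ModuleCat.{0} R} (f : M₁ →ₗ[R] M₂)
    (g : M₂ →ₗ[R] M₃) (hf : Function.Injective f) (hfg : Function.Exact f g)
    (hg : Function.Surjective g) :
    (shortComplexOfCompEqZero f g hfg.linearMap_comp_eq_zero).ShortExact :=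
  shortComplex_shortExact _ hfg hf hg

variable [IsLocalRing R] [IsNoetherianRing R]

open IsLocalRing

/-- By Nakayama, `Ext` vanishes on `M` if it vanishes one degree up on `M / rM`, for `r` a
nonunit regular on `M`. -/
lemma subsingleton_ext_of_quotSMulTop (M W : ModuleCat.{0} R) [Module.Finite R M]
    [Module.Finite R W] {r : R} (hr : r ∈ maximalIdeal R) (hreg : IsSMulRegular M r) (n : ℕ)
    (h : Subsingleton (Abelian.Ext (ModuleCat.of R (QuotSMulTop r M)) W (n + 1))) :
    Subsingleton (Abelian.Ext M W n) := by
  rw [← Submodule.subsingleton_iff R, ← subsingleton_iff_bot_eq_top, eq_comm]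
  refine Submodule.eq_bot_of_le_smul_of_le_jacobson_bot (maximalIdeal R) _
    Module.Finite.fg_top ?_ (IsLocalRing.jacobson_eq_maximalIdeal ⊥ bot_ne_top).ge
  intro e _
  obtain ⟨e', rfl⟩ := Ext.contravariant_sequence_exact₁ hreg.smulShortComplex_shortExact W e
    (add_comm 1 n) (h.elim _ _)
  have hsmul (a : Abelian.Ext M W n) :
      (Ext.mk₀ (r • 𝟙 M)).comp a (zero_add n) ∈ maximalIdeal R • (⊤ : Submodule R _) := by
    rw [Ext.mk₀_smul, Ext.smul_comp, Ext.mk₀_id_comp]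
    exact Submodule.smul_mem_smul hr trivial
  exact hsmul e'

/-- If `Ext` against `W` vanishes on the residue field in degrees `> d` and `W` has finite
injective dimension, then `Ext` against `W` vanishes on all finite modules in degrees `> d`. -/
lemma subsingleton_ext_of_residueField (W : ModuleCat.{0} R) [Module.Finite R W] (d : ℕ)
    (hfin : ∃ m : ℕ, ∀ (N : ModuleCat.{0} R) (i : ℕ), m < i → Subsingleton (Abelian.Ext N W i))
    (hk : ∀ i, d < i → Subsingleton (Abelian.Ext (ModuleCat.of R (ResidueField R)) W i))
    (N : ModuleCat.{0} R) [Module.Finite R N] (i : ℕ) (hi : d < i) :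
    Subsingleton (Abelian.Ext N W i) := by
  obtain ⟨m, hm⟩ := hfin
  obtain ⟨j, hj⟩ : ∃ j, m < i + j := ⟨m + 1, by lia⟩
  induction j generalizing i N with
  | zero => exact hm N i hj
  | succ j ih =>
    have key : ∀ (L : Type) [AddCommGroup L] [Module R L] [Module.Finite R L],
        Subsingleton (Abelian.Ext (ModuleCat.of R L) W i) := by
      intro L _ _ hL
      induction hL using IsNoetherianRing.induction_on_isQuotientEquivQuotientPrime R with
      | subsingleton L =>
        obtain ⟨n, rfl⟩ : ∃ n, i = n + 1 := ⟨i - 1, by lia⟩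
        have : Projective (ModuleCat.of R L) := inferInstance
        exact subsingleton_of_forall_eq 0 Ext.eq_zero_of_projective
      | quotient L p e =>
        refine subsingleton_ext_of_iso e.symm.toModuleIso i ?_
        by_cases hp : p.1 = maximalIdeal R
        · rw [hp]; exact hk i hi
        · obtain ⟨r, hr, hrp⟩ := SetLike.exists_of_lt
            (lt_of_le_of_ne (le_maximalIdeal p.2.ne_top) hp)
          refine subsingleton_ext_of_quotSMulTop _ W hr ?_ i (ih _ (i + 1) (by lia) (by lia))
          exact (isSMulRegular_quotient_iff_mem_of_smul_mem p.1 r).mpr fun a ha ↦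
            (p.2.mem_or_mem ha).resolve_left hrp
      | exact N₁ N₂ N₃ f g hf hg hfg h₁ h₃ =>
        exact (shortExact_of_function_exact (M₁ := .of R N₁) (M₂ := .of R N₂) (M₃ := .of R N₃)
          f g hf hfg hg).subsingleton_ext_X₂_contravariant W i h₁ h₃
    exact key N

/-- A finite module with `Hom(k, M) = 0` has a regular element in the maximal ideal. -/
lemma exists_isSMulRegular_of_subsingleton_hom (M : ModuleCat.{0} R) [Module.Finite R M]
    (h : Subsingleton (Abelian.Ext (ModuleCat.of R (ResidueField R)) M 0)) :
    ∃ r ∈ maximalIdeal R, IsSMulRegular M r := by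
  have : Subsingleton (ResidueField R →ₗ[R] M) :=
    ((Ext.addEquiv₀.trans ModuleCat.homAddEquiv :
      Abelian.Ext (ModuleCat.of R (ResidueField R)) M 0 ≃+ _).symm).subsingleton
  obtain ⟨r, hr, hreg⟩ := IsSMulRegular.subsingleton_linearMap_iff.mp this
  have hr' : r ∈ Module.annihilator R (R ⧸ maximalIdeal R) := hr
  rw [Ideal.annihilator_quotient] at hr'
  exact ⟨r, hr', hreg⟩

/-- If `Ext^j(k, M) = 0` for `j < t` then `Ext^i(M, W) = 0` for `i > d - t`, whenever
`Ext^i(-, W)` vanishes on finite modules for `i > d`. -/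
lemma subsingleton_ext_of_depth (W : ModuleCat.{0} R) [Module.Finite R W] (d : ℕ)
    (hW : ∀ (N : ModuleCat.{0} R) [Module.Finite R N] (i : ℕ), d < i →
      Subsingleton (Abelian.Ext N W i))
    (t : ℕ) (M : ModuleCat.{0} R) [Module.Finite R M]
    (hM : ∀ j < t, Subsingleton (Abelian.Ext (ModuleCat.of R (ResidueField R)) M j))
    (i : ℕ) (hi : d < i + t) : Subsingleton (Abelian.Ext M W i) := by
  induction t generalizing M i with
  | zero => exact hW M i hi
  | succ t ih =>
    obtain ⟨r, hr, hreg⟩ := exists_isSMulRegular_of_subsingleton_hom M (hM 0 t.succ_pos)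
    refine subsingleton_ext_of_quotSMulTop M W hr hreg i (ih _ (fun j hj ↦ ?_) (i + 1) (by lia))
    exact hreg.smulShortComplex_shortExact.subsingleton_ext_X₃_covariant _ j
      (hM (j + 1) (by lia)) (hM j (by lia))

end ModuleCat

namespace ModuleCat

open Abelian IsLocalRing Pointwise

variable {R : Type} [CommRing R]

/-- Vanishing of `Ext(k, W)` passes to `Hom(F, W)` for `F` finite free. -/
lemma subsingleton_ext_linearMap_pi (k W : ModuleCat.{0} R) (n j : ℕ)
    (h : Subsingleton (Abelian.Ext k W j)) :
    Subsingleton (Abelian.Ext k (ModuleCat.of R ((Fin n → R) →ₗ[R] W)) j) := by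
  refine subsingleton_of_forall_eq 0 fun e ↦ ?_
  let H := ModuleCat.of R ((Fin n → R) →ₗ[R] W)
  let p (i : Fin n) : H ⟶ W := ModuleCat.ofHom (LinearMap.applyₗ (Pi.single i 1))
  let q (i : Fin n) : W ⟶ H :=
    ModuleCat.ofHom ((LinearMap.lcomp R W (LinearMap.proj i)) ∘ₗ
      (LinearMap.ringLmapEquivSelf R R W).symm.toLinearMap)
  have hid : ∑ i, p i ≫ q i = 𝟙 H := by
    ext φ : 2
    refine LinearMap.pi_ext' fun i ↦ LinearMap.ext_ring ?_
    simp [p, q, H]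
  rw [← Ext.comp_mk₀_id e]
  change e.comp (Ext.mk₀ (𝟙 H)) _ = 0
  rw [← hid, Ext.mk₀_sum, Ext.comp_sum]
  refine Finset.sum_eq_zero fun i _ ↦ ?_
  rw [← Ext.mk₀_comp_mk₀, ← Ext.comp_assoc_of_second_deg_zero,
    Subsingleton.elim (e.comp (Ext.mk₀ (p i)) _) 0, Ext.zero_comp]

/-- If `Ext^1(M₃, W) = 0` then restriction `Hom(M₂, W) → Hom(M₁, W)` is surjective. -/
lemma exists_extension_of_subsingleton_ext {S : ShortComplex (ModuleCat.{0} R)}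
    (hS : S.ShortExact) (W : ModuleCat.{0} R) (h : Subsingleton (Abelian.Ext S.X₃ W 1))
    (φ : S.X₁ ⟶ W) : ∃ ψ : S.X₂ ⟶ W, S.f ≫ ψ = φ := by
  obtain ⟨e, he⟩ := Ext.contravariant_sequence_exact₁ hS W (Ext.mk₀ φ) (add_zero 1)
    (Subsingleton.elim _ _)
  obtain ⟨ψ, rfl⟩ := Ext.addEquiv₀.symm.surjective e
  refine ⟨ψ, Ext.addEquiv₀.symm.injective ?_⟩
  simpa using he

variable [IsNoetherianRing R]

/-- If `Ext^i(M, W) = 0` for `i > 0`, then the depth of `Hom(M, W)` is at least that of `W`. -/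
lemma subsingleton_ext_linearMap (k W : ModuleCat.{0} R) (d : ℕ)
    (hk : ∀ j < d, Subsingleton (Abelian.Ext k W j)) (M : ModuleCat.{0} R) [Module.Finite R M]
    (hM : ∀ i, 0 < i → Subsingleton (Abelian.Ext M W i)) (j : ℕ) (hj : j < d) :
    Subsingleton (Abelian.Ext k (ModuleCat.of R (M →ₗ[R] W)) j) := by
  induction j using Nat.strong_induction_on generalizing M with
  | h j ih =>
    obtain ⟨n, f, hf⟩ := Module.Finite.exists_fin' R M
    have hS := LinearMap.shortExact_shortComplexKer hf
    have : Projective (ModuleCat.of R (Fin n → R)) := inferInstance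
    have hT := shortExact_of_function_exact
      (M₁ := .of R (M →ₗ[R] W)) (M₂ := .of R ((Fin n → R) →ₗ[R] W))
      (M₃ := .of R (LinearMap.ker f →ₗ[R] W))
      (LinearMap.lcomp R W f) (LinearMap.lcomp R W (LinearMap.ker f).subtype)
      (LinearMap.lcomp_injective_of_surjective f hf)
      (LinearMap.exact_lcomp_of_exact_of_surjective _
        (LinearMap.exact_subtype_ker_map f) hf)
      (by
        intro φ
        obtain ⟨ψ, hψ⟩ := exists_extension_of_subsingleton_ext hS W (hM 1 one_pos)
          (ModuleCat.ofHom φ)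
        exact ⟨ψ.hom, ModuleCat.hom_ext_iff.1 hψ⟩)
    have hF := subsingleton_ext_linearMap_pi k W n _ (hk _ hj)
    cases j with
    | zero => exact hT.subsingleton_ext_X₁_covariant_zero k hF
    | succ j =>
      refine hT.subsingleton_ext_X₁_covariant k j hF
        (ih j (by lia) (ModuleCat.of R (LinearMap.ker f)) (fun i hi ↦ ?_) (by lia))
      refine hS.subsingleton_ext_X₁_contravariant W i ?_ (hM (i + 1) (by lia))
      obtain ⟨i, rfl⟩ : ∃ n, i = n + 1 := ⟨i - 1, by lia⟩
      exact subsingleton_of_forall_eq 0 Ext.eq_zero_of_projective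

variable [IsLocalRing R]

/-- A finite module whose `Ext` against `W` vanishes in all degrees is zero, if `W` is a module
with `Ext^d(k, W) ≠ 0` and `Ext^(d+1)(-, W) = 0` on finite modules. -/
lemma subsingleton_of_subsingleton_ext (W : ModuleCat.{0} R) (d : ℕ)
    (hW : ∀ (N : ModuleCat.{0} R) [Module.Finite R N],
      Subsingleton (Abelian.Ext N W (d + 1)))
    (hk : Nontrivial (Abelian.Ext (ModuleCat.of R (ResidueField R)) W d))
    (M : ModuleCat.{0} R) [Module.Finite R M]
    (hM : ∀ i, Subsingleton (Abelian.Ext M W i)) : Subsingleton M := by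
  suffices H : ∀ N : Submodule R M,
      (∀ i, Subsingleton (Abelian.Ext (ModuleCat.of R (M ⧸ N)) W i)) → Subsingleton (M ⧸ N) from
    (Submodule.quotEquivOfEqBot ⊥ rfl).symm.toEquiv.subsingleton_congr.mpr
      (H ⊥ fun i ↦ subsingleton_ext_of_iso
        (Submodule.quotEquivOfEqBot (⊥ : Submodule R M) rfl).symm.toModuleIso i (hM i))
  intro N
  induction N using IsNoetherian.induction with
  | hgt N ih =>
    intro hN
    let Q := ModuleCat.of R (M ⧸ N)
    have hhom : Subsingleton (Abelian.Ext (ModuleCat.of R (ResidueField R)) Q 0) := by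
      by_contra hne
      rw [not_subsingleton_iff_nontrivial] at hne
      have : Nontrivial (ResidueField R →ₗ[R] Q) :=
        ((Ext.addEquiv₀.trans ModuleCat.homAddEquiv :
          Abelian.Ext (ModuleCat.of R (ResidueField R)) Q 0 ≃+ _).symm).nontrivial
      obtain ⟨φ, hφ⟩ := exists_ne (0 : ResidueField R →ₗ[R] Q)
      have : IsSimpleModule R (ResidueField R) :=
        isSimpleModule_iff_isCoatom.mpr (maximalIdeal.isMaximal R).out
      have hinj := (LinearMap.injective_or_eq_zero φ).resolve_right hφ
      have hS := shortExact_of_function_exact (M₁ := .of R (ResidueField R)) (M₂ := Q)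
        (M₃ := .of R (Q ⧸ LinearMap.range φ)) φ (LinearMap.range φ).mkQ hinj
        φ.exact_map_mkQ_range (Submodule.mkQ_surjective _)
      exact not_subsingleton _ (hS.subsingleton_ext_X₁_contravariant W d (hN d) (hW _))
    obtain ⟨r, hr, hreg⟩ := exists_isSMulRegular_of_subsingleton_hom Q hhom
    let J : Submodule R M := Submodule.comap N.mkQ (r • ⊤)
    have hNJ : N ≤ J := Submodule.le_comap_mkQ N _
    have hmap : J.map N.mkQ = r • ⊤ :=
      Submodule.map_comap_eq_of_surjective (Submodule.mkQ_surjective N) _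
    let e : QuotSMulTop r (M ⧸ N) ≃ₗ[R] M ⧸ J :=
      (Submodule.quotEquivOfEq _ _ hmap.symm).trans
        (Submodule.quotientQuotientEquivQuotient N J hNJ)
    have hJ : ∀ i, Subsingleton (Abelian.Ext (ModuleCat.of R (M ⧸ J)) W i) := by
      have hS := hreg.smulShortComplex_shortExact
      intro i
      refine subsingleton_ext_of_iso e.toModuleIso i ?_
      cases i with
      | zero => exact hS.subsingleton_ext_X₃_contravariant_zero W (hN 0)
      | succ i => exact hS.subsingleton_ext_X₃_contravariant W i (hN i) (hN (i + 1))
    by_contra hne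
    rw [not_subsingleton_iff_nontrivial] at hne
    rcases hNJ.lt_or_eq with hlt | heq
    · have := ih J hlt hJ
      have := nontrivial_quotSMulTop_of_mem_maximalIdeal (M ⧸ N) hr
      exact not_subsingleton _ e.toEquiv.subsingleton
    · refine not_subsingleton (M ⧸ N) (subsingleton_of_forall_eq 0 fun q ↦ hreg ?_)
      have hq : r • q ∈ r • (⊤ : Submodule R (M ⧸ N)) :=
        Submodule.smul_mem_pointwise_smul _ _ _ trivial
      rw [← hmap, ← heq, Submodule.mkQ_map_self] at hq
      simpa using hq

end ModuleCat

namespace ModuleCat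

open Abelian IsLocalRing

variable {R : Type} [CommRing R]

lemma smul_eq_apply_smul_id {I : Ideal R} {x : R} (hx : x ∈ I)
    (s : I →ₗ[R] I) : x • s = (s ⟨x, hx⟩ : R) • LinearMap.id := by
  ext y
  have h : x • y = (y : R) • (⟨x, hx⟩ : I) := Subtype.ext (mul_comm _ _)
  have := congrArg Subtype.val (congrArg s h)
  simp only [map_smul, Submodule.coe_smul, smul_eq_mul] at this
  simpa [mul_comm] using this

/-- The connecting map `I → Ext^1(I / xR, I)` for an ideal `I` without self-extensions whose
endomorphisms are homotheties. -/
lemma exists_surjective_ext_one (I : Ideal R) {x : R} (hx : x ∈ I)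
    (hreg : x ∈ nonZeroDivisors R)
    (hI : Subsingleton (Abelian.Ext (ModuleCat.of R I) (ModuleCat.of R I) 1))
    (hEnd : ∀ s : I →ₗ[R] I, ∃ r : R, s = r • LinearMap.id) :
    ∃ ψ : I →ₗ[R] Abelian.Ext (qmod R I (Ideal.span {x})) (ModuleCat.of R I) 1,
      Function.Surjective ψ ∧ ∀ w, ψ w = 0 ↔ (w : R) ∈ Ideal.span {x} := by
  let W := ModuleCat.of R I
  let f : R →ₗ[R] I := LinearMap.toSpanSingleton R I ⟨x, hx⟩
  have hf : Function.Injective f := by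
    rw [← LinearMap.ker_eq_bot, LinearMap.ker_eq_bot']
    intro r hr
    have := congrArg Subtype.val hr
    exact (mul_right_mem_nonZeroDivisors_eq_zero_iff hreg).mp (by simpa [f] using this)
  have hfg : Function.Exact f (Submodule.comap I.subtype (Ideal.span {x})).mkQ := by
    intro w
    simp only [Submodule.mkQ_apply, Submodule.Quotient.mk_eq_zero, Submodule.mem_comap,
      Submodule.subtype_apply, Ideal.mem_span_singleton', Set.mem_range]
    exact exists_congr fun r ↦ by simp [f, Subtype.ext_iff]
  have hS := shortExact_of_function_exact (M₁ := .of R R) (M₂ := W)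
    (M₃ := qmod R I (Ideal.span {x})) f _ hf hfg (Submodule.mkQ_surjective _)
  let e : I ≃ₗ[R] Abelian.Ext (ModuleCat.of R R) W 0 :=
    (LinearMap.ringLmapEquivSelf R R I).symm ≪≫ₗ
      (ModuleCat.homLinearEquiv (M := .of R R) (N := W) (S := R)).symm ≪≫ₗ
      (Ext.linearEquiv₀ (R := R)).symm
  refine ⟨hS.extClass.precompOfLinear R W (add_zero 1) ∘ₗ e.toLinearMap, fun a ↦ ?_, fun w ↦ ?_⟩
  · obtain ⟨b, hb⟩ := Ext.contravariant_sequence_exact₃ hS W a (hI.elim _ _) (add_zero 1)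
    exact ⟨e.symm b, by simpa using hb⟩
  · change hS.extClass.comp (e w) (add_zero 1) = 0 ↔ _
    have key (s : I →ₗ[R] I) : (Ext.mk₀ (ofHom f)).comp (Ext.mk₀ (ofHom s : W ⟶ W)) (zero_add 0) =
        e (s ⟨x, hx⟩) := by
      rw [Ext.mk₀_comp_mk₀]
      refine congrArg Ext.mk₀ (ModuleCat.hom_ext (LinearMap.ext_ring ?_))
      simp only [f, W, hom_comp, hom_ofHom, LinearMap.comp_apply, LinearMap.toSpanSingleton_apply,
        one_smul]
      exact (one_smul R _).symm
    rw [Ideal.mem_span_singleton']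
    constructor
    · intro h
      obtain ⟨b, hb⟩ := Ext.contravariant_sequence_exact₁ hS W (e w) (add_zero 1) h
      obtain ⟨s, rfl⟩ := Ext.addEquiv₀.symm.surjective b
      obtain ⟨r, hr⟩ := hEnd s.hom
      refine ⟨r, ?_⟩
      have := e.injective ((key s.hom).symm.trans hb)
      simpa [hr] using congrArg Subtype.val this
    · rintro ⟨r, hr⟩
      have : w = (r • LinearMap.id : I →ₗ[R] I) ⟨x, hx⟩ := Subtype.ext (by simp [hr])
      rw [this, ← key]
      exact hS.extClass_comp_assoc _

variable [IsLocalRing R] [IsNoetherianRing R]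

/-- A module with the homological properties of a canonical module has no self-extensions. -/
lemma subsingleton_ext_self (W : ModuleCat.{0} R) [Module.Finite R W] (d : ℕ)
    (hfin : ∃ m : ℕ, ∀ (N : ModuleCat.{0} R) (i : ℕ), m < i → Subsingleton (Abelian.Ext N W i))
    (hk : ∀ i ≠ d, Subsingleton (Abelian.Ext (ModuleCat.of R (ResidueField R)) W i))
    (i : ℕ) (hi : 0 < i) : Subsingleton (Abelian.Ext W W i) :=
  subsingleton_ext_of_depth W d
    (fun N _ i hi ↦ subsingleton_ext_of_residueField W d hfin (fun i hi ↦ hk i hi.ne') N i hi)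
    d W (fun j hj ↦ hk j hj.ne) i (by lia)

/-- Every endomorphism of a canonical ideal containing a regular element is a homothety. -/
lemma exists_smul_id_eq (I : Ideal R) (d : ℕ)
    (hfin : ∃ m : ℕ, ∀ (N : ModuleCat.{0} R) (i : ℕ), m < i →
      Subsingleton (Abelian.Ext N (ModuleCat.of R I) i))
    (hk : ∀ i ≠ d,
      Subsingleton (Abelian.Ext (ModuleCat.of R (ResidueField R)) (ModuleCat.of R I) i))
    (hd : Nontrivial (Abelian.Ext (ModuleCat.of R (ResidueField R)) (ModuleCat.of R I) d))
    {x : R} (hx : x ∈ I) (hreg : x ∈ nonZeroDivisors R) (s : I →ₗ[R] I) :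
    ∃ r : R, s = r • LinearMap.id := by
  let W := ModuleCat.of R I
  have hW (N : ModuleCat.{0} R) [Module.Finite R N] (i : ℕ) (hi : d < i) :
      Subsingleton (Abelian.Ext N W i) :=
    subsingleton_ext_of_residueField W d hfin (fun i hi ↦ hk i hi.ne') N i hi
  have hWW (i : ℕ) (hi : 0 < i) : Subsingleton (Abelian.Ext W W i) :=
    subsingleton_ext_self W d hfin hk i hi
  let S := ModuleCat.of R (I →ₗ[R] I)
  have hSW (i : ℕ) (hi : 0 < i) : Subsingleton (Abelian.Ext S W i) :=
    subsingleton_ext_of_depth W d hW d S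
      (fun j hj ↦ subsingleton_ext_linearMap _ W d (fun j hj ↦ hk j hj.ne) W hWW j hj) i (by lia)
  let f : R →ₗ[R] (I →ₗ[R] I) := LinearMap.toSpanSingleton R _ LinearMap.id
  have hf : Function.Injective f := by
    rw [← LinearMap.ker_eq_bot, LinearMap.ker_eq_bot']
    intro r hr
    have := congrArg Subtype.val (LinearMap.congr_fun hr ⟨x, hx⟩)
    exact (mul_right_mem_nonZeroDivisors_eq_zero_iff hreg).mp (by simpa [f] using this)
  have hT := shortExact_of_function_exact (M₁ := .of R R) (M₂ := S)
    (M₃ := .of R (S ⧸ LinearMap.range f)) f (LinearMap.range f).mkQ hf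
    f.exact_map_mkQ_range (Submodule.mkQ_surjective _)
  have h0 : Subsingleton (Abelian.Ext (ModuleCat.of R (S ⧸ LinearMap.range f)) W 0) := by
    have : Subsingleton ((S ⧸ LinearMap.range f) →ₗ[R] I) := by
      refine subsingleton_of_forall_eq 0 fun φ ↦ ?_
      refine Submodule.linearMap_qext _ (LinearMap.ext fun s ↦ Subtype.ext ?_)
      have := congrArg (fun t ↦ (φ (Submodule.Quotient.mk t) : R)) (smul_eq_apply_smul_id hx s)
      have h1 : (Submodule.Quotient.mk LinearMap.id : S ⧸ LinearMap.range f) = 0 :=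
        (Submodule.Quotient.mk_eq_zero _).mpr ⟨1, by simp [f]⟩
      simp only [Submodule.Quotient.mk_smul, map_smul, h1] at this
      exact (mul_left_mem_nonZeroDivisors_eq_zero_iff hreg).mp (by simpa using this)
    exact (Ext.addEquiv₀.trans ModuleCat.homAddEquiv :
      Abelian.Ext (ModuleCat.of R (S ⧸ LinearMap.range f)) W 0 ≃+ _).subsingleton
  have : Projective (ModuleCat.of R R) := inferInstance
  have hC (i : ℕ) : Subsingleton (Abelian.Ext (ModuleCat.of R (S ⧸ LinearMap.range f)) W i) := by
    match i with
    | 0 => exact h0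
    | 1 =>
      refine subsingleton_of_forall_eq 0 fun e ↦ ?_
      obtain ⟨φ, rfl⟩ := Ext.contravariant_sequence_exact₃ hT W e
        ((hSW 1 one_pos).elim _ _) (add_zero 1)
      obtain ⟨φ, rfl⟩ := Ext.addEquiv₀.symm.surjective φ
      have : ∃ ψ : S ⟶ W, φ = ModuleCat.ofHom f ≫ ψ :=
        ⟨ModuleCat.ofHom (LinearMap.applyₗ (φ.hom 1)), by
          ext
          simp [f, W, S]⟩
      obtain ⟨ψ, rfl⟩ := this
      simpa using hT.extClass_comp_assoc (Ext.mk₀ ψ) (h := add_zero 1)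
    | i + 2 =>
      exact hT.subsingleton_ext_X₃_contravariant W (i + 1)
        (subsingleton_of_forall_eq 0 Ext.eq_zero_of_projective) (hSW _ (by lia))
  have := subsingleton_of_subsingleton_ext W d (fun N _ ↦ hW N _ (by lia)) hd _ hC
  obtain ⟨r, hr⟩ : s ∈ LinearMap.range f :=
    (Submodule.Quotient.mk_eq_zero _).mp (Subsingleton.elim (α := S ⧸ LinearMap.range f) _ _)
  exact ⟨r, hr.symm⟩

end ModuleCat

/-- The exact sequence `0 → I → R × E → R / J → 0` induced by an isomorphism `I / J ≅ E`. -/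
lemma exists_exact_of_surjective {R E : Type*} [CommRing R] [AddCommGroup E] [Module R E]
    {I J : Ideal R} (hJI : J ≤ I) (ψ : I →ₗ[R] E) (hψ : Function.Surjective ψ)
    (hker : ∀ w, ψ w = 0 ↔ (w : R) ∈ J) :
    ∃ (f : I →ₗ[R] R × E) (g : R × E →ₗ[R] R ⧸ J),
      Function.Injective f ∧ Function.Exact f g ∧ Function.Surjective g := by
  let φ : I →ₗ[R] R ⧸ J := J.mkQ ∘ₗ I.subtype
  have hφ : LinearMap.ker ψ ≤ LinearMap.ker φ := fun w hw ↦
    (Submodule.Quotient.mk_eq_zero J).mpr ((hker w).mp hw)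
  let χ : E →ₗ[R] R ⧸ J :=
    (LinearMap.ker ψ).liftQ φ hφ ∘ₗ (ψ.quotKerEquivOfSurjective hψ).symm.toLinearMap
  have hχ (w : I) : χ (ψ w) = J.mkQ w := by
    simp [χ, φ, LinearMap.quotKerEquivOfSurjective_symm_apply]
  refine ⟨I.subtype.prod ψ, J.mkQ.coprod (-χ), fun a b h ↦ Subtype.ext (congrArg Prod.fst h),
    fun ⟨r, e⟩ ↦ ⟨fun h ↦ ?_, ?_⟩, fun a ↦ ?_⟩
  · obtain ⟨w, rfl⟩ := hψ e
    have hr : r - w ∈ J := by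
      rw [← Submodule.Quotient.mk_eq_zero, Submodule.Quotient.mk_sub]
      simpa [hχ, sub_eq_add_neg] using h
    refine ⟨w + ⟨r - w, hJI hr⟩, Prod.ext (by simp) ?_⟩
    simpa using (hker _).mpr hr
  · rintro ⟨w, hw⟩
    obtain ⟨rfl, rfl⟩ := Prod.ext_iff.mp hw
    simp [hχ]
  · obtain ⟨r, rfl⟩ := J.mkQ_surjective a
    exact ⟨(r, 0), by simp⟩

theorem stmt11 (R : Type) [CommRing R] [IsLocalRing R]
    (hCM : IsCMLocalRing R) (hGG : IsGenericallyGorenstein R)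
    (hnG : ¬ IsGorensteinLocalRing R)
    (ω : Ideal R) (hω : IsCanonicalIdeal R ω)
    (x : R) (hxω : x ∈ ω) (hxreg : x ∈ nonZeroDivisors R) :
    ∃ (f : ↥ω →ₗ[R] (R × (ModExt R 1 (qmod R ω (Ideal.span {x})) (ModuleCat.of R ↥ω))))
      (g : (R × (ModExt R 1 (qmod R ω (Ideal.span {x})) (ModuleCat.of R ↥ω))) →ₗ[R] (R ⧸ Ideal.span {x})),
      Function.Injective f ∧ Function.Exact f g ∧ Function.Surjective g := by
  have := hCM.1
  have := hω.1
  obtain ⟨-, ⟨m, hm⟩, d, -, ⟨hd⟩, hk⟩ := hω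
  have hfin : ∃ m : ℕ, ∀ (N : ModuleCat.{0} R) (i : ℕ), m < i →
      Subsingleton (Abelian.Ext N (ModuleCat.of R ω) i) := ⟨m, fun N i hi ↦
    have := hm N i hi
    (ModuleCat.nonempty_modExt_linearEquiv N (.of R ω) i).some.symm.subsingleton⟩
  have hk' (i : ℕ) (hi : i ≠ d) : Subsingleton
      (Abelian.Ext (ModuleCat.of R (IsLocalRing.ResidueField R)) (ModuleCat.of R ω) i) :=
    have := hk i hi
    (ModuleCat.nonempty_modExt_linearEquiv _ _ i).some.symm.subsingleton
  have hd' : Nontrivial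
      (Abelian.Ext (ModuleCat.of R (IsLocalRing.ResidueField R)) (ModuleCat.of R ω) d) :=
    ((ModuleCat.nonempty_modExt_linearEquiv _ _ d).some.symm ≪≫ₗ hd).toEquiv.nontrivial
  obtain ⟨ψ, hψ, hker⟩ := ModuleCat.exists_surjective_ext_one ω hxω hxreg
    (ModuleCat.subsingleton_ext_self _ d hfin hk' 1 one_pos)
    (ModuleCat.exists_smul_id_eq ω d hfin hk' hd' hxω hxreg)
  obtain ⟨e⟩ := ModuleCat.nonempty_modExt_linearEquiv (qmod R ω (Ideal.span {x})) (.of R ω) 1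
  exact exists_exact_of_surjective ((Ideal.span_singleton_le_iff_mem ω).mpr hxω)
    (e.symm.toLinearMap ∘ₗ ψ) (e.symm.surjective.comp hψ) fun w ↦ by simp [hker]

end
end

section
/- Let (R,𝔪) be a Cohen-Macaulay local ring with canonical module that is generically Gorenstein and not Gorenstein, and let ω be a canonical ideal of R. Then the short exact sequence 0 → ω → R → R/ω → 0 is the minimal MCM approximation of R/ω; in particular δ_R(R/ω) = 1 and X_{R/ω} ≅ R. -/
open CategoryTheory

noncomputable section

section

open CategoryTheory Abelian IsLocalRing RingTheory.Sequence Pointwise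

section ExtComparison

variable {R : Type} [CommRing R]

lemma subsingleton_ext_of_subsingleton_modExt {M N : ModuleCat R} {n : ℕ}
    (h : Subsingleton (ModExt R n M N)) : Subsingleton (Abelian.Ext M N n) := by
  let P := projectiveResolution M
  rw [(P.isoExt (R := R) n N).toLinearEquiv.toEquiv.subsingleton_congr,
    ← ModuleCat.isZero_iff_subsingleton, ← HomologicalComplex.exactAt_iff_isZero_homology] at h
  rw [subsingleton_iff_forall_eq 0]
  intro α
  obtain ⟨f, hf, rfl⟩ := P.extMk_surjective α (n + 1) rfl
  cases n with
  | zero =>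
    rw [HomologicalComplex.exactAt_iff' _ 0 0 1 (CochainComplex.prev_nat_zero) (by simp),
      ShortComplex.moduleCat_exact_iff] at h
    obtain ⟨g, hg⟩ := h f hf
    have hd : P.complex.d 0 0 = 0 := P.complex.shape _ _ (by simp)
    have hf0 : f = 0 := hg.symm.trans <|
      (congrArg (· ≫ (g : P.complex.X 0 ⟶ N)) hd).trans Limits.zero_comp
    subst hf0
    simp
  | succ n =>
    rw [HomologicalComplex.exactAt_iff' _ n (n + 1) (n + 2) (by simp) (by simp),
      ShortComplex.moduleCat_exact_iff] at h
    rw [P.extMk_eq_zero_iff _ _ _ _ n rfl]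
    exact h f hf

end ExtComparison

section LocalRing

variable {R : Type} [CommRing R] [IsLocalRing R] [IsNoetherianRing R]

lemma subsingleton_ext_of_quotSMulTop {M W : ModuleCat R} [Module.Finite R M] [Module.Finite R W]
    {r : R} (hr : r ∈ maximalIdeal R) (hreg : IsSMulRegular M r) {i : ℕ}
    (h : Subsingleton (Ext (ModuleCat.of R (QuotSMulTop r M)) W (i + 1))) :
    Subsingleton (Ext M W i) := by
  have htop : (⊤ : Submodule R (Ext M W i)) ≤ Ideal.span {r} • ⊤ := by
    rintro x -
    have hx : ∃ y : Ext M W i, (Ext.mk₀ (r • 𝟙 M)).comp y (zero_add i) = x :=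
      Ext.contravariant_sequence_exact₁ hreg.smulShortComplex_shortExact W x (add_comm 1 i)
        (Subsingleton.elim (α := Ext (ModuleCat.of R (QuotSMulTop r M)) W (i + 1)) _ _)
    obtain ⟨y, hy⟩ := hx
    rw [Ext.mk₀_smul, Ext.smul_comp, Ext.mk₀_id_comp] at hy
    rw [← hy]
    exact Submodule.smul_mem_smul (Ideal.mem_span_singleton_self r) trivial
  have hbot := Submodule.eq_bot_of_le_smul_of_le_jacobson_bot _ _ Module.Finite.fg_top htop
    (by rw [jacobson_eq_maximalIdeal ⊥ bot_ne_top]; simpa using hr)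
  exact (Submodule.subsingleton_iff R).mp (subsingleton_of_bot_eq_top hbot.symm)

lemma subsingleton_ext_of_residueField_s13 {W : ModuleCat R} [Module.Finite R W] {n : ℕ}
    (hk : Subsingleton (Ext (ModuleCat.of R (ResidueField R)) W n))
    (hsucc : ∀ M : ModuleCat R, Module.Finite R M → Subsingleton (Ext M W (n + 1)))
    (M : ModuleCat R) (hM : Module.Finite R M) : Subsingleton (Ext M W n) := by
  suffices H : ∀ (M : Type) [AddCommGroup M] [Module R M] (_ : Module.Finite R M),
      Subsingleton (Ext (ModuleCat.of R M) W n) from H M hM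
  intro M _ _ hM
  induction hM using IsNoetherianRing.induction_on_isQuotientEquivQuotientPrime R with
  | subsingleton N =>
    rw [subsingleton_iff_forall_eq 0]
    intro x
    have hN : Limits.IsZero (ModuleCat.of R N) := ModuleCat.isZero_of_subsingleton _
    rw [← Ext.mk₀_id_comp x, hN.eq_of_src (𝟙 _) 0, Ext.mk₀_zero, Ext.zero_comp]
  | quotient N p e =>
    by_cases hp : maximalIdeal R ≤ p.1
    · have hp : p.1 = maximalIdeal R := (le_maximalIdeal p.2.ne_top).antisymm hp
      have e' : ModuleCat.of R N ≅ ModuleCat.of R (ResidueField R) :=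
        (e.trans (Submodule.quotEquivOfEq _ _ hp)).toModuleIso
      rw [subsingleton_iff_forall_eq 0]
      intro x
      rw [← Ext.mk₀_id_comp x, ← e'.hom_inv_id, ← Ext.mk₀_comp_mk₀_assoc,
        Subsingleton.elim ((Ext.mk₀ e'.inv).comp x (zero_add n)) 0, Ext.comp_zero]
    · obtain ⟨r, hr, hrp⟩ := SetLike.not_le_iff_exists.mp hp
      refine subsingleton_ext_of_quotSMulTop (M := ModuleCat.of R N) hr ?_
        (hsucc _ (inferInstanceAs (Module.Finite R (QuotSMulTop r N))))
      refine (e.isSMulRegular_congr r).mpr (isSMulRegular_iff_right_eq_zero_of_smul.mpr ?_)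
      intro x hx
      obtain ⟨a, rfl⟩ := Ideal.Quotient.mk_surjective x
      change Ideal.Quotient.mk p.1 (r * a) = 0 at hx
      rw [Ideal.Quotient.eq_zero_iff_mem] at hx ⊢
      exact (p.2.mem_or_mem hx).resolve_left hrp
  | exact N₁ N₂ N₃ f g hf hg hfg h₁ h₃ =>
    let S := ModuleCat.shortComplexOfCompEqZero f g hfg.linearMap_comp_eq_zero
    have hS : S.ShortExact := ModuleCat.shortComplex_shortExact S hfg hf hg
    rw [subsingleton_iff_forall_eq 0]
    intro x
    obtain ⟨y, hy⟩ := Ext.contravariant_sequence_exact₂ hS W x (h₁.elim _ _)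
    rw [← hy, h₃.elim y 0, Ext.comp_zero]

lemma IsCanonicalModule.subsingleton_ext {W : ModuleCat R} (hW : IsCanonicalModule R W)
    {d : ℕ} (hd : ringKrullDim R = d) (M : ModuleCat R) [Module.Finite R M] {i : ℕ}
    (hi : d < i) : Subsingleton (Ext M W i) := by
  obtain ⟨_, ⟨b, hb⟩, d', hd', -, hk⟩ := hW
  obtain rfl : d' = d := by exact_mod_cast hd'.symm.trans hd
  suffices H : ∀ (j i : ℕ), d' < i → b < i + j → ∀ M : ModuleCat R, Module.Finite R M →
      Subsingleton (Ext M W i) from H (b + 1) i hi (by lia) M inferInstance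
  intro j
  induction j with
  | zero => exact fun i _ hi M _ ↦ subsingleton_ext_of_subsingleton_modExt (hb M i hi)
  | succ j ih =>
    exact fun i hi hij ↦ subsingleton_ext_of_residueField_s13
      (subsingleton_ext_of_subsingleton_modExt (hk i hi.ne')) (ih (i + 1) (by lia) (by lia))

lemma IsCanonicalModule.subsingleton_ext_of_isWeaklyRegular {W : ModuleCat R}
    (hW : IsCanonicalModule R W) {d : ℕ} (hd : ringKrullDim R = d) (rs : List R)
    (hrs : ∀ r ∈ rs, r ∈ maximalIdeal R) (M : ModuleCat R) [Module.Finite R M]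
    (hreg : IsWeaklyRegular M rs) {i : ℕ} (hi : d < i + rs.length) :
    Subsingleton (Ext M W i) := by
  have := hW.1
  induction rs generalizing M i with
  | nil => exact hW.subsingleton_ext hd M hi
  | cons r rs ih =>
    rw [isWeaklyRegular_cons_iff] at hreg
    rw [List.forall_mem_cons] at hrs
    rw [List.length_cons] at hi
    exact subsingleton_ext_of_quotSMulTop hrs.1 hreg.1
      (ih hrs.2 (ModuleCat.of R (QuotSMulTop r M)) hreg.2 (by lia))

lemma IsMCM.subsingleton_ext {W X : ModuleCat R} (hX : IsMCM R X) (hW : IsCanonicalModule R W)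
    [Nontrivial X] {i : ℕ} (hi : 0 < i) : Subsingleton (Ext X W i) := by
  obtain ⟨_, hdepth⟩ := hX
  obtain ⟨d, hd, -⟩ := hW.2.2
  rw [hd] at hdepth
  have hdepth : moduleDepth R X = d := by exact_mod_cast hdepth
  have hvanish : ∀ j < d, Subsingleton (Ext (ModuleCat.of R (ResidueField R)) X j) := by
    intro j hj
    apply subsingleton_ext_of_subsingleton_modExt
    by_contra hnt
    have hle : moduleDepth R X ≤ j := sInf_le ⟨j, rfl, not_subsingleton_iff_nontrivial.mp hnt⟩
    rw [hdepth] at hle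
    exact hj.not_ge (by exact_mod_cast hle)
  have hlt : maximalIdeal R • (⊤ : Submodule R X) < ⊤ :=
    (Submodule.top_ne_ideal_smul_of_le_jacobson_annihilator
      (maximalIdeal_le_jacobson _)).symm.lt_top
  obtain ⟨rs, hlen, hmem, hreg⟩ := ModuleCat.exists_isRegular_of_exists_subsingleton_ext
    (maximalIdeal R) d X hlt (ModuleCat.of R (ResidueField R))
    (by
      change Module.support R (R ⧸ maximalIdeal R) = _
      rw [Module.support_eq_zeroLocus, Ideal.annihilator_quotient]) hvanish
  exact hW.subsingleton_ext_of_isWeaklyRegular hd rs hmem X hreg.toIsWeaklyRegular (by lia)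

end LocalRing

section Lifting

variable {R : Type} [CommRing R]

lemma exists_comp_eq_of_subsingleton_ext {X A B C : ModuleCat.{0} R} {f : A →ₗ[R] B} {g : B →ₗ[R] C}
    (hf : Function.Injective f) (hg : Function.Surjective g) (hfg : Function.Exact f g)
    (h : Subsingleton (Ext X A 1)) (π : X →ₗ[R] C) : ∃ φ : X →ₗ[R] B, g ∘ₗ φ = π := by
  let S := ModuleCat.shortComplexOfCompEqZero f g hfg.linearMap_comp_eq_zero
  have hS : S.ShortExact := ModuleCat.shortComplex_shortExact S hfg hf hg
  obtain ⟨x, hx⟩ := Ext.covariant_sequence_exact₃ X hS (Ext.mk₀ (ModuleCat.ofHom π)) (zero_add 1)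
    (h.elim _ _)
  obtain ⟨φ, rfl⟩ := Ext.homEquiv₀.symm.surjective x
  refine ⟨φ.hom, ?_⟩
  rw [Ext.homEquiv₀_symm_apply, Ext.mk₀_comp_mk₀] at hx
  exact congrArg ModuleCat.Hom.hom (Ext.homEquiv₀.symm.injective hx)

end Lifting

section CommonSummand

variable {R : Type} [CommRing R]

/-- A surjection split by `s` exhibits its target as a direct factor. -/
def LinearMap.equivProdKer {X N : Type*} [AddCommGroup X] [Module R X] [AddCommGroup N]
    [Module R N] (p : X →ₗ[R] N) (s : N →ₗ[R] X) (h : ∀ n, p (s n) = n) :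
    X ≃ₗ[R] N × LinearMap.ker p where
  toFun x := (p x, ⟨x - s (p x), by simp [h]⟩)
  map_add' x y := by ext <;> simp; abel
  map_smul' r x := by ext <;> simp [smul_sub]
  invFun z := s z.1 + z.2
  left_inv x := by simp
  right_inv z := by ext <;> simp [h]

lemma hasCommonSummandVia_of_section {Y X N : ModuleCat.{0} R} [Nontrivial N] (ι : Y →ₗ[R] X)
    (p : X →ₗ[R] N) (s : N →ₗ[R] Y) (h : ∀ n, p (ι (s n)) = n) : HasCommonSummandVia R ι :=
  ⟨N, ModuleCat.of R (LinearMap.ker (p ∘ₗ ι)), ModuleCat.of R (LinearMap.ker p), ‹_›,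
    (p ∘ₗ ι).equivProdKer s h, p.equivProdKer (ι ∘ₗ s) h,
    ι.restrict fun _ hy ↦ hy,
    fun y ↦ Prod.ext rfl (Subtype.ext (map_sub ι y (s (p (ι y)))).symm)⟩

lemma eq_top_of_hasCommonSummandVia_subtype [IsLocalRing R] {I : Ideal R}
    (h : HasCommonSummandVia R (Y := ModuleCat.of R I) (X := ModuleCat.of R R) I.subtype) :
    I = ⊤ := by
  obtain ⟨N, Y', X', hN, e, f, ι', hcomm⟩ := h
  have hmem : ∀ n : N, (f.symm (n, 0) : R) ∈ I := by
    intro n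
    have := hcomm (e.symm (n, 0))
    rw [e.apply_symm_apply, map_zero, ← f.eq_symm_apply] at this
    rw [← this]
    exact (e.symm (n, 0) : I).2
  let φ : R →ₗ[R] R :=
    f.symm.toLinearMap ∘ₗ LinearMap.inl R N X' ∘ₗ LinearMap.fst R N X' ∘ₗ f.toLinearMap
  have hφ : ∀ r, φ r = r * φ 1 := fun r ↦ by
    rw [← smul_eq_mul, ← map_smul, smul_eq_mul, mul_one]
  have hidem : φ (φ 1) = φ 1 := by simp [φ]
  rw [hφ] at hidem
  rcases IsLocalRing.isUnit_or_isUnit_one_sub_self (φ 1) with hu | hu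
  · exact I.eq_top_of_isUnit_mem (hmem _) hu
  · have h0 : φ 1 = 0 := by
      refine (hu.mul_left_eq_zero).mp ?_
      rw [mul_sub, mul_one, hidem, sub_self]
    exfalso
    obtain ⟨n, hn⟩ := exists_ne (0 : N)
    have hr : φ (f.symm (n, 0)) = f.symm (n, 0) := by simp [φ]
    rw [hφ, h0, mul_zero] at hr
    exact hn (congrArg Prod.fst ((f.symm.map_eq_zero_iff).mp hr.symm))

lemma injective_of_not_hasCommonSummandVia {Y X C : ModuleCat.{0} R} {B : Type} [AddCommGroup B]
    [Module R B] {ι : Y →ₗ[R] X} {π : X →ₗ[R] C} (hι : Function.Injective ι)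
    (hexact : Function.Exact ι π) (hmin : ¬ HasCommonSummandVia R ι) (h : X →ₗ[R] B)
    (g : B →ₗ[R] X) (hg : ∀ b, h (g b) = b) (hker : LinearMap.ker h ≤ LinearMap.ker π) :
    Function.Injective h := by
  rw [← LinearMap.ker_eq_bot, ← Submodule.subsingleton_iff_eq_bot]
  by_contra hnt
  rw [not_subsingleton_iff_nontrivial] at hnt
  let p : X →ₗ[R] LinearMap.ker h :=
    (LinearMap.id - g ∘ₗ h).codRestrict _ fun x ↦ by simp [hg]
  let s : LinearMap.ker h →ₗ[R] Y :=
    (LinearEquiv.ofInjective ι hι).symm.toLinearMap ∘ₗ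
      Submodule.inclusion (hker.trans hexact.linearMap_ker_eq.le)
  have hs : ∀ n, ι (s n) = n := fun n ↦
    LinearEquiv.ofInjective_symm_apply ι (h := hι) (Submodule.inclusion _ n)
  refine hmin (hasCommonSummandVia_of_section (N := ModuleCat.of R (LinearMap.ker h)) ι p s ?_)
  intro n
  rw [hs]
  ext
  simp [p]

end CommonSummand

lemma freeRank_eq_one_of_linearEquiv {R : Type} [CommRing R] [Nontrivial R] {X : ModuleCat R}
    (e : X ≃ₗ[R] R) : freeRank R X = 1 := by
  apply le_antisymm
  · refine sSup_le ?_
    rintro _ ⟨m, rfl, X', ⟨f⟩⟩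
    have hinj : Function.Injective
        ((e.toLinearMap ∘ₗ f.symm.toLinearMap) ∘ₗ LinearMap.inl R (Fin m → R) X') :=
      (e.injective.comp f.symm.injective).comp LinearMap.inl_injective
    have := LinearMap.finrank_le_finrank_of_injective hinj
    simp only [Module.finrank_fin_fun, Module.finrank_self] at this
    exact_mod_cast this
  · exact le_sSup ⟨1, rfl, ModuleCat.of R PUnit,
      ⟨e ≪≫ₗ (LinearEquiv.funUnique (Fin 1) R R).symm ≪≫ₗ LinearEquiv.prodUnique.symm⟩⟩

lemma HasFiniteInjDim.of_linearEquiv {R : Type} [CommRing R] {M N : ModuleCat R}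
    (h : HasFiniteInjDim R M) (e : M ≃ₗ[R] N) : HasFiniteInjDim R N := by
  obtain ⟨n, hn⟩ := h
  refine ⟨n, fun L i hi ↦ ?_⟩
  have := hn L i hi
  exact (((Ext R (ModuleCat R) i).obj (Opposite.op L)).mapIso
    e.toModuleIso).toLinearEquiv.symm.toEquiv.subsingleton

end

theorem stmt13 (R : Type) [CommRing R] [IsLocalRing R]
    (hCM : IsCMLocalRing R) (hGG : IsGenericallyGorenstein R)
    (hnG : ¬ IsGorensteinLocalRing R)
    (ω : Ideal R) (hω : IsCanonicalIdeal R ω) :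
    IsMinMCMApprox R (ModuleCat.of R (R ⧸ ω)) (ModuleCat.of R ↥ω) (ModuleCat.of R R)
      ω.subtype ω.mkQ ∧
    (∀ (Y X : ModuleCat R) (ι : Y →ₗ[R] X) (π : X →ₗ[R] ModuleCat.of R (R ⧸ ω)),
      IsMinMCMApprox R (ModuleCat.of R (R ⧸ ω)) Y X ι π →
        freeRank R X = 1 ∧ Nonempty (X ≃ₗ[R] R)) := by
  have := hCM.1
  have hωtop : ω ≠ ⊤ := by
    rintro rfl
    exact hnG ⟨hCM.1, ‹_›, hω.2.1.of_linearEquiv (N := ModuleCat.of R R) Submodule.topEquiv⟩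
  have hexact : Function.Exact ω.subtype ω.mkQ := fun x ↦ by
    simp [Ideal.Quotient.eq_zero_iff_mem]
  refine ⟨⟨⟨inferInstanceAs (Module.Finite R (R ⧸ ω)), hω.1,
    ⟨inferInstanceAs (Module.Finite R R), hCM.2⟩, hω.2.1, ω.injective_subtype,
    ω.mkQ_surjective, hexact⟩,
    fun h ↦ hωtop (eq_top_of_hasCommonSummandVia_subtype h)⟩, ?_⟩
  rintro Y X ι π ⟨⟨-, -, hX, -, hι, hπ, hιπ⟩, hmin⟩
  have : Nontrivial (R ⧸ ω) := Ideal.Quotient.nontrivial_iff.mpr hωtop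
  have : Nontrivial X := hπ.nontrivial
  obtain ⟨h, hh⟩ := exists_comp_eq_of_subsingleton_ext (X := X) (A := ModuleCat.of R ω)
    (B := ModuleCat.of R R) (C := ModuleCat.of R (R ⧸ ω)) (f := ω.subtype) (g := ω.mkQ)
    ω.injective_subtype ω.mkQ_surjective hexact (hX.subsingleton_ext hω one_pos) π
  obtain ⟨x, hx⟩ := hπ (ω.mkQ 1)
  have hu : IsUnit (h x : R) := by
    have hmem : (h x : R) - 1 ∈ ω := by
      rw [← Submodule.ker_mkQ ω, LinearMap.mem_ker, map_sub, sub_eq_zero, ← hx, ← hh]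
      rfl
    by_contra hnu
    have := (IsLocalRing.maximalIdeal R).sub_mem ((IsLocalRing.mem_maximalIdeal _).mpr hnu)
      (IsLocalRing.le_maximalIdeal hωtop hmem)
    simp at this
  obtain ⟨u, hu⟩ := hu
  let g : R →ₗ[R] X := LinearMap.toSpanSingleton R X ((↑u⁻¹ : R) • x)
  have hg : ∀ r, (h (g r) : R) = r := fun r ↦ by
    simp [g, ← hu]
  have hker : LinearMap.ker h ≤ LinearMap.ker π := by
    rw [← hh]
    exact LinearMap.ker_le_ker_comp h _
  have hbij : Function.Bijective h :=
    ⟨injective_of_not_hasCommonSummandVia hι hιπ hmin h g hg hker, fun r ↦ ⟨g r, hg r⟩⟩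
  let e : X ≃ₗ[R] R := LinearEquiv.ofBijective h hbij
  exact ⟨freeRank_eq_one_of_linearEquiv e, ⟨e⟩⟩

end
end

section
/- Let (R,𝔪) be a Cohen-Macaulay local ring with canonical module that is generically Gorenstein and not Gorenstein, let ω be a canonical ideal of R, let x ∈ ω be an R-regular element, and let n ≥ 1. Dualizing the short exact sequence 0 → x^nR/x^{n+1}R → ω/x^{n+1}R → ω/x^nR → 0 by Ext^1_R(−, ω) yields a short exact sequence 0 → Ext^1_R(ω/x^nR, ω) → Ext^1_R(ω/x^{n+1}R, ω) → ω/xω → 0. -/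
open CategoryTheory

noncomputable section

/-- The homology of a short complex of modules, described through a parametrization of its
cycles. -/
lemma CategoryTheory.ShortComplex.exists_linearMap_homology {R : Type*} [Ring R]
    (S : ShortComplex (ModuleCat R)) {A : Type*} [AddCommGroup A] [Module R A]
    (c : A →ₗ[R] S.X₂) (hc : LinearMap.range c = LinearMap.ker S.g.hom) :
    ∃ q : A →ₗ[R] S.homology, Function.Surjective q ∧
      ∀ a, q a = 0 ↔ c a ∈ LinearMap.range S.f.hom := by
  have hmem (a : A) : c a ∈ LinearMap.ker S.g.hom := hc ▸ LinearMap.mem_range_self c a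
  let e := S.moduleCatHomologyIso.toLinearEquiv
  refine ⟨e.symm.toLinearMap ∘ₗ (LinearMap.range S.moduleCatToCycles).mkQ ∘ₗ
    c.codRestrict _ hmem, ?_, fun a => ?_⟩
  · refine e.symm.surjective.comp ((Submodule.mkQ_surjective _).comp ?_)
    rintro ⟨y, hy⟩
    obtain ⟨a, rfl⟩ : y ∈ LinearMap.range c := hc ▸ hy
    exact ⟨a, rfl⟩
  · have h : e.symm ((LinearMap.range S.moduleCatToCycles).mkQ (c.codRestrict _ hmem a)) = 0 ↔
        c.codRestrict _ hmem a ∈ LinearMap.range S.moduleCatToCycles :=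
      (LinearEquiv.map_eq_zero_iff e.symm).trans (Submodule.Quotient.mk_eq_zero _)
    refine h.trans ⟨?_, ?_⟩
    · rintro ⟨z, hz⟩
      exact ⟨z, congrArg Subtype.val hz⟩
    · rintro ⟨z, hz⟩
      exact ⟨z, Subtype.ext hz⟩

/-- Surjections from projective modules onto the same module `M`, with kernels `K'` and `K`, give
the same cokernel of `Hom(P, N) → Hom(K, N)`. -/
lemma exists_linearMap_of_projective_surjective {R P P' M N E : Type*} [CommRing R]
    [AddCommGroup P] [AddCommGroup P'] [AddCommGroup M] [AddCommGroup N] [AddCommGroup E]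
    [Module R P] [Module R P'] [Module R M] [Module R N] [Module R E]
    [Module.Projective R P] [Module.Projective R P']
    (p : P →ₗ[R] M) (hp : Function.Surjective p) (p' : P' →ₗ[R] M) (hp' : Function.Surjective p')
    (q' : (LinearMap.ker p' →ₗ[R] N) →ₗ[R] E) (hq' : Function.Surjective q')
    (hq₀' : ∀ φ, q' φ = 0 ↔ ∃ ψ : P' →ₗ[R] N, ψ.domRestrict (LinearMap.ker p') = φ) :
    ∃ q : (LinearMap.ker p →ₗ[R] N) →ₗ[R] E, Function.Surjective q ∧
      ∀ φ, q φ = 0 ↔ ∃ ψ : P →ₗ[R] N, ψ.domRestrict (LinearMap.ker p) = φ := by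
  obtain ⟨u, hu⟩ := Module.projective_lifting_property p p' hp
  obtain ⟨v, hv⟩ := Module.projective_lifting_property p' p hp'
  have hu (y : P') : p (u y) = p' y := LinearMap.congr_fun hu y
  have hv (y : P) : p' (v y) = p y := LinearMap.congr_fun hv y
  let u₀ : LinearMap.ker p' →ₗ[R] LinearMap.ker p := u.restrict fun y hy => by
    simpa [hu] using hy
  let v₀ : LinearMap.ker p →ₗ[R] LinearMap.ker p' := v.restrict fun y hy => by
    simpa [hv] using hy
  let s : P →ₗ[R] LinearMap.ker p := (u ∘ₗ v - LinearMap.id).codRestrict _ fun y => by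
    simp [hu, hv]
  let s' : P' →ₗ[R] LinearMap.ker p' := (v ∘ₗ u - LinearMap.id).codRestrict _ fun y => by
    simp [hu, hv]
  have hs (y : LinearMap.ker p) : s y = u₀ (v₀ y) - y := rfl
  have hs' (y : LinearMap.ker p') : s' y = v₀ (u₀ y) - y := rfl
  refine ⟨q' ∘ₗ LinearMap.lcomp R N u₀, fun e => ?_, fun φ => (hq₀' _).trans ⟨?_, ?_⟩⟩
  · obtain ⟨φ, rfl⟩ := hq' e
    refine ⟨φ ∘ₗ v₀, sub_eq_zero.1 ?_⟩
    rw [LinearMap.comp_apply, ← map_sub, hq₀']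
    refine ⟨φ ∘ₗ s', LinearMap.ext fun y => ?_⟩
    simp [hs']
  · rintro ⟨ψ, hψ⟩
    refine ⟨ψ ∘ₗ v - φ ∘ₗ s, LinearMap.ext fun y => ?_⟩
    have : ψ (v y) = φ (u₀ (v₀ y)) := LinearMap.congr_fun hψ (v₀ y)
    simp [hs, this]
  · rintro ⟨ψ, rfl⟩
    exact ⟨ψ ∘ₗ u, rfl⟩

/-- A linear map vanishing on the kernel of a surjection factors through it. -/
lemma LinearMap.exists_comp_eq_of_ker_le {R A B D : Type*} [Ring R] [AddCommGroup A]
    [AddCommGroup B] [AddCommGroup D] [Module R A] [Module R B] [Module R D]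
    (q : A →ₗ[R] B) (hq : Function.Surjective q) (h : A →ₗ[R] D) (hle : ker q ≤ ker h) :
    ∃ f : B →ₗ[R] D, ∀ a, f (q a) = h a := by
  refine ⟨(ker q).liftQ h hle ∘ₗ (q.quotKerEquivOfSurjective hq).symm.toLinearMap, fun a => ?_⟩
  have : (q.quotKerEquivOfSurjective hq).symm (q a) = Submodule.Quotient.mk a := by
    rw [LinearEquiv.symm_apply_eq]; rfl
  simp [this]

/-- `Ext¹(M, N)` is the cokernel of the restriction map `Hom(P, N) → Hom(K, N)`, where `P → M` is
a surjection from a projective module with kernel `K`. -/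
lemma exists_linearMap_modExt_one {R : Type} [CommRing R] {P : Type} [AddCommGroup P] [Module R P]
    [Module.Projective R P] {M : ModuleCat.{0} R} (p : P →ₗ[R] M) (hp : Function.Surjective p)
    (N : ModuleCat.{0} R) :
    ∃ q : (LinearMap.ker p →ₗ[R] N) →ₗ[R] ModExt R 1 M N, Function.Surjective q ∧
      ∀ φ, q φ = 0 ↔ ∃ ψ : P →ₗ[R] N, ψ.domRestrict (LinearMap.ker p) = φ := by
  let Q := projectiveResolution M
  let p₀ : Q.complex.X 0 ⟶ M := Q.π.f 0
  have hp₀ : Function.Surjective p₀.hom :=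
    (ModuleCat.epi_iff_surjective (Q.π.f 0)).1 inferInstance
  have : Module.Projective R (Q.complex.X 0) :=
    (IsProjective.iff_projective (Q.complex.X 0)).2 (Q.projective 0)
  suffices h : ∃ q : (LinearMap.ker p₀.hom →ₗ[R] N) →ₗ[R] ModExt R 1 M N, Function.Surjective q ∧
      ∀ φ, q φ = 0 ↔ ∃ ψ : Q.complex.X 0 →ₗ[R] N, ψ.domRestrict (LinearMap.ker p₀.hom) = φ by
    obtain ⟨q, hq, hq₀⟩ := h
    exact exists_linearMap_of_projective_surjective p hp p₀.hom hp₀ q hq hq₀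
  let K := LinearMap.ker p₀.hom
  let d₁ := Q.complex.d 1 0
  have hd₁ : LinearMap.range d₁.hom = K := Q.exact₀.moduleCat_range_eq_ker
  have hd₂ : LinearMap.range (Q.complex.d 2 1).hom = LinearMap.ker d₁.hom :=
    (Q.exact_succ 0).moduleCat_range_eq_ker
  let π : Q.complex.X 1 →ₗ[R] K := d₁.hom.codRestrict K fun y => hd₁ ▸ LinearMap.mem_range_self _ y
  have hπ : Function.Surjective π := by
    rintro ⟨k, hk⟩
    rw [← hd₁] at hk
    obtain ⟨y, rfl⟩ := hk
    exact ⟨y, rfl⟩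
  let S := (Q.complex.linearYonedaObj R N).sc' 0 1 2
  let c : (K →ₗ[R] N) →ₗ[R] S.X₂ :=
    { toFun := fun φ => (ModuleCat.ofHom (φ ∘ₗ π) : Q.complex.X 1 ⟶ N)
      map_add' := fun _ _ => rfl
      map_smul' := fun _ _ => rfl }
  have hc : LinearMap.range c = LinearMap.ker S.g.hom := by
    ext (a : Q.complex.X 1 ⟶ N)
    have hg : a ∈ LinearMap.ker S.g.hom ↔ Q.complex.d 2 1 ≫ a = 0 := Iff.rfl
    refine Iff.trans ⟨?_, ?_⟩ hg.symm
    · rintro ⟨φ, rfl⟩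
      ext y
      have : d₁.hom ((Q.complex.d 2 1).hom y) = 0 := by
        rw [← LinearMap.mem_ker, ← hd₂]
        exact LinearMap.mem_range_self _ y
      have h : π ((Q.complex.d 2 1).hom y) = 0 := Subtype.ext this
      change φ (π ((Q.complex.d 2 1).hom y)) = 0
      rw [h, map_zero]
    · intro ha
      have hker : LinearMap.ker π ≤ LinearMap.ker a.hom := by
        intro y hy
        have : y ∈ LinearMap.ker d₁.hom := congrArg Subtype.val (LinearMap.mem_ker.1 hy)
        rw [← hd₂] at this
        obtain ⟨z, rfl⟩ := this
        exact congr($ha z)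
      obtain ⟨φ, hφ⟩ := π.exists_comp_eq_of_ker_le hπ a.hom hker
      exact ⟨φ, ModuleCat.hom_ext (LinearMap.ext hφ)⟩
  obtain ⟨q, hq, hq₀⟩ := S.exists_linearMap_homology c hc
  let e : ModExt R 1 M N ≃ₗ[R] S.homology :=
    (Q.isoExt 1 N ≪≫ (Q.complex.linearYonedaObj R N).homologyIsoSc' 0 1 2
      (by simp) (by simp)).toLinearEquiv
  refine ⟨e.symm.toLinearMap ∘ₗ q, e.symm.surjective.comp hq, fun φ => ?_⟩
  have h : e.symm (q φ) = 0 ↔ q φ = 0 := LinearEquiv.map_eq_zero_iff _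
  refine h.trans ((hq₀ φ).trans ⟨?_, ?_⟩)
  · rintro ⟨(ψ : Q.complex.X 0 ⟶ N), (hψ : d₁ ≫ ψ = ModuleCat.ofHom (φ ∘ₗ π))⟩
    refine ⟨ψ.hom, LinearMap.ext fun k => ?_⟩
    obtain ⟨y, rfl⟩ := hπ k
    exact congr($hψ y)
  · rintro ⟨ψ, rfl⟩
    exact ⟨(ModuleCat.ofHom ψ : Q.complex.X 0 ⟶ N), rfl⟩

/-- Extend a linear map along `K' ≤ K`, where `K` is generated by `K'` and one element `k₀` with
`r • k₀ ∈ K' ↔ x ∣ r`, by sending `k₀` to any `y` with `x • y = φ (x • k₀)`. -/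
lemma Submodule.exists_extend_of_sup_span_singleton {R P N : Type*} [CommRing R]
    [AddCommGroup P] [AddCommGroup N] [Module R P] [Module R N] {K K' : Submodule R P} {k₀ : P}
    {x : R} (hK : K = K' ⊔ span R {k₀}) (hdvd : ∀ r : R, r • k₀ ∈ K' → x ∣ r)
    (hx : x • k₀ ∈ K') (φ : K' →ₗ[R] N) (y : N) (hy : φ ⟨x • k₀, hx⟩ = x • y) :
    ∃ ψ : K →ₗ[R] N, ∀ k (hk : k ∈ K) (hk' : k ∈ K'), ψ ⟨k, hk⟩ = φ ⟨k, hk'⟩ := by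
  have hmem (z : K' × R) : (z.1 : P) + z.2 • k₀ ∈ K := by
    rw [hK]
    exact add_mem (mem_sup_left z.1.2) (mem_sup_right (smul_mem _ _ (mem_span_singleton_self k₀)))
  let π : K' × R →ₗ[R] K :=
    (LinearMap.coprod K'.subtype (LinearMap.toSpanSingleton R P k₀)).codRestrict K hmem
  have hπ : Function.Surjective π := by
    rintro ⟨k, hk⟩
    have hk₂ := hk
    rw [hK, mem_sup] at hk₂
    obtain ⟨a, ha, b, hb, rfl⟩ := hk₂
    obtain ⟨r, rfl⟩ := mem_span_singleton.1 hb
    exact ⟨(⟨a, ha⟩, r), rfl⟩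
  obtain ⟨ψ, hψ⟩ := π.exists_comp_eq_of_ker_le hπ
    (LinearMap.coprod φ (LinearMap.toSpanSingleton R N y)) (by
      rintro ⟨⟨a, ha⟩, r⟩ h
      have h : a + r • k₀ = 0 := congrArg Subtype.val (LinearMap.mem_ker.1 h)
      obtain ⟨s, rfl⟩ := hdvd r (by
        rw [← neg_eq_of_add_eq_zero_right h]
        exact K'.neg_mem ha)
      have ha' : (⟨a, ha⟩ : K') = -(s • ⟨x • k₀, hx⟩) := by
        refine Subtype.ext ?_
        simpa [smul_smul, mul_comm s x] using eq_neg_of_add_eq_zero_left h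
      rw [LinearMap.mem_ker, LinearMap.coprod_apply, ha', map_neg, map_smul, hy,
        LinearMap.toSpanSingleton_apply, smul_smul, mul_comm s x, neg_add_cancel])
  refine ⟨ψ, fun k hk hk' => ?_⟩
  have h : π (⟨k, hk'⟩, 0) = ⟨k, hk⟩ := Subtype.ext (show k + (0 : R) • k₀ = k by simp)
  rw [← h, hψ]
  simp

/-- Let `K' ≤ K ≤ P` with `K / K'` generated by the class of `k₀`, whose annihilator is generated
by an `N`-regular element `x`, and suppose some functional on `K'` takes the value `1` modulo `x` at
`x • k₀`. Then the cokernels `E` and `E'` of `Hom(P, N) → Hom(K, N)` and `Hom(P, N) → Hom(K', N)` fit into a short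
exact sequence `0 → E → E' → N / xN → 0`. -/
lemma exists_shortExact_of_cyclic_quotient {R P N E E' : Type*} [CommRing R]
    [AddCommGroup P] [AddCommGroup N] [AddCommGroup E] [AddCommGroup E']
    [Module R P] [Module R N] [Module R E] [Module R E'] {K K' : Submodule R P} {k₀ : P} {x : R}
    (hK : K = K' ⊔ Submodule.span R {k₀}) (hdvd : ∀ r : R, r • k₀ ∈ K' → x ∣ r)
    (hx : x • k₀ ∈ K') (hreg : ∀ y : N, x • y = 0 → y = 0)
    (l : K' →ₗ[R] R) (hl : x ∣ l ⟨x • k₀, hx⟩ - 1)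
    (q : (K →ₗ[R] N) →ₗ[R] E) (hq : Function.Surjective q)
    (hq₀ : ∀ φ, q φ = 0 ↔ ∃ ψ : P →ₗ[R] N, ψ.domRestrict K = φ)
    (q' : (K' →ₗ[R] N) →ₗ[R] E') (hq' : Function.Surjective q')
    (hq₀' : ∀ φ, q' φ = 0 ↔ ∃ ψ : P →ₗ[R] N, ψ.domRestrict K' = φ)
    (S : Submodule R N) (hS : ∀ y, y ∈ S ↔ ∃ z, y = x • z) :
    ∃ (f : E →ₗ[R] E') (g : E' →ₗ[R] N ⧸ S),
      Function.Injective f ∧ Function.Exact f g ∧ Function.Surjective g := by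
  have hle : K' ≤ K := hK ▸ le_sup_left
  have hk₀ : k₀ ∈ K := by
    rw [hK]
    exact Submodule.mem_sup_right (Submodule.mem_span_singleton_self k₀)
  let ι : K' →ₗ[R] K := Submodule.inclusion hle
  let ev : (K' →ₗ[R] N) →ₗ[R] N ⧸ S := S.mkQ ∘ₗ LinearMap.applyₗ ⟨x • k₀, hx⟩
  have hev (φ : K' →ₗ[R] N) : ev φ = 0 ↔ ∃ z, φ ⟨x • k₀, hx⟩ = x • z := by
    rw [← hS]
    exact Submodule.Quotient.mk_eq_zero S
  have hevι (φ : K →ₗ[R] N) : ev (φ ∘ₗ ι) = 0 :=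
    (hev _).2 ⟨φ ⟨k₀, hk₀⟩, φ.map_smul x ⟨k₀, hk₀⟩⟩
  obtain ⟨f, hf⟩ := q.exists_comp_eq_of_ker_le hq (q' ∘ₗ LinearMap.lcomp R N ι) (by
    intro φ hφ
    obtain ⟨ψ, rfl⟩ := (hq₀ φ).1 hφ
    exact (hq₀' _).2 ⟨ψ, rfl⟩)
  obtain ⟨g, hg⟩ := q'.exists_comp_eq_of_ker_le hq' ev (by
    intro φ hφ
    obtain ⟨ψ, rfl⟩ := (hq₀' φ).1 hφ
    exact hevι (ψ.domRestrict K))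
  have hf (φ : K →ₗ[R] N) : f (q φ) = q' (φ ∘ₗ ι) := hf φ
  refine ⟨f, g, ?_, ?_, ?_⟩
  · refine (injective_iff_map_eq_zero f).2 fun e he => ?_
    obtain ⟨φ, rfl⟩ := hq e
    rw [hf, hq₀'] at he
    obtain ⟨ψ, hψ⟩ := he
    refine (hq₀ φ).2 ⟨ψ, ?_⟩
    have hK' (k : P) (hk : k ∈ K') : φ ⟨k, hle hk⟩ = ψ k :=
      (LinearMap.congr_fun hψ ⟨k, hk⟩).symm
    have h₀ : φ ⟨k₀, hk₀⟩ = ψ k₀ := by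
      refine sub_eq_zero.1 (hreg _ ?_)
      rw [smul_sub, ← map_smul, ← map_smul, sub_eq_zero]
      exact hK' _ hx
    refine LinearMap.ext fun ⟨k, hk⟩ => ?_
    have hk₂ := hk
    rw [hK, Submodule.mem_sup] at hk₂
    obtain ⟨a, ha, b, hb, rfl⟩ := hk₂
    obtain ⟨r, rfl⟩ := Submodule.mem_span_singleton.1 hb
    have : (⟨a + r • k₀, hk⟩ : K) = ⟨a, hle ha⟩ + r • ⟨k₀, hk₀⟩ := rfl
    rw [this, map_add φ, map_smul φ, h₀, hK' a ha]
    simp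
  · intro e
    obtain ⟨φ, rfl⟩ := hq' e
    rw [hg, hev]
    constructor
    · rintro ⟨y, hy⟩
      obtain ⟨ψ, hψ⟩ :=
        Submodule.exists_extend_of_sup_span_singleton hK hdvd hx φ y hy
      exact ⟨q ψ, by rw [hf]; exact congrArg q' (LinearMap.ext fun k => hψ k _ k.2)⟩
    · rintro ⟨e, he⟩
      obtain ⟨ψ, rfl⟩ := hq e
      rw [← hev, ← hg, ← he, hf, hg, hevι]
  · intro y
    obtain ⟨y, rfl⟩ := S.mkQ_surjective y
    refine ⟨q' (LinearMap.toSpanSingleton R N y ∘ₗ l), ?_⟩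
    rw [hg]
    refine (Submodule.Quotient.eq S).2 ((hS _).2 ?_)
    obtain ⟨c, hc⟩ := hl
    refine ⟨c • y, ?_⟩
    simp [smul_smul, ← hc, sub_smul]

theorem stmt14 (R : Type) [CommRing R] [IsLocalRing R]
    (hCM : IsCMLocalRing R) (hGG : IsGenericallyGorenstein R)
    (hnG : ¬ IsGorensteinLocalRing R)
    (ω : Ideal R) (hω : IsCanonicalIdeal R ω)
    (x : R) (hxω : x ∈ ω) (hxreg : x ∈ nonZeroDivisors R)
    (n : ℕ) (hn : 1 ≤ n) :
    ∃ (f : (ModExt R 1 (qmod R ω (Ideal.span {x ^ n})) (ModuleCat.of R ↥ω)) →ₗ[R] (ModExt R 1 (qmod R ω (Ideal.span {x ^ (n + 1)})) (ModuleCat.of R ↥ω)))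
      (g : (ModExt R 1 (qmod R ω (Ideal.span {x ^ (n + 1)})) (ModuleCat.of R ↥ω)) →ₗ[R] (qmod R ω (Ideal.span {x} * ω))),
      Function.Injective f ∧ Function.Exact f g ∧ Function.Surjective g := by
  have hmemω {m : ℕ} (hm : 1 ≤ m) : x ^ m ∈ ω := ω.pow_mem_of_mem hxω m hm
  have hregn (m : ℕ) : x ^ m ∈ nonZeroDivisors R := pow_mem hxreg m
  have hspan {a : R} {w : ω} :
      w ∈ Submodule.comap ω.subtype (Ideal.span {a}) ↔ ∃ r, r * a = w :=
    Ideal.mem_span_singleton'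
  let L := Submodule.comap ω.subtype (Ideal.span {x ^ n})
  let L' := Submodule.comap ω.subtype (Ideal.span {x ^ (n + 1)})
  let P := ω →₀ R
  let t : P →ₗ[R] ω := Finsupp.linearCombination R id
  have ht : Function.Surjective t := Finsupp.linearCombination_id_surjective R ω
  let p : P →ₗ[R] ω ⧸ L := L.mkQ ∘ₗ t
  let p' : P →ₗ[R] ω ⧸ L' := L'.mkQ ∘ₗ t
  have hp (k : P) : k ∈ LinearMap.ker p ↔ ∃ r, r * x ^ n = t k :=
    (Submodule.Quotient.mk_eq_zero L).trans hspan
  have hp' (k : P) : k ∈ LinearMap.ker p' ↔ ∃ r, r * x ^ (n + 1) = t k :=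
    (Submodule.Quotient.mk_eq_zero L').trans hspan
  obtain ⟨q, hq, hq₀⟩ := exists_linearMap_modExt_one (M := qmod R ω (Ideal.span {x ^ n})) p
    (L.mkQ_surjective.comp ht) (ModuleCat.of R ω)
  obtain ⟨q', hq', hq₀'⟩ := exists_linearMap_modExt_one
    (M := qmod R ω (Ideal.span {x ^ (n + 1)})) p' (L'.mkQ_surjective.comp ht) (ModuleCat.of R ω)
  obtain ⟨k₀, hk₀⟩ := ht ⟨x ^ n, hmemω hn⟩
  have hx : x • k₀ ∈ LinearMap.ker p' := (hp' _).2 ⟨1, by simp [hk₀, pow_succ']⟩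
  have hdiv (m : ℕ) {a b : R} (h : a * x ^ m = b * x ^ m) : a = b :=
    (mul_cancel_right_mem_nonZeroDivisors (hregn m)).1 h
  let e := LinearEquiv.ofInjective (LinearMap.toSpanSingleton R R (x ^ (n + 1)))
    fun _ _ h => hdiv (n + 1) h
  let l : LinearMap.ker p' →ₗ[R] R := e.symm.toLinearMap ∘ₗ
    ((ω.subtype ∘ₗ t).domRestrict (LinearMap.ker p')).codRestrict _ fun k => (hp' k).1 k.2
  have hl (k : LinearMap.ker p') : l k * x ^ (n + 1) = t k :=
    congrArg Subtype.val (e.apply_symm_apply ⟨t k, (hp' k).1 k.2⟩)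
  have hl₁ : l ⟨x • k₀, hx⟩ = 1 := by
    refine hdiv (n + 1) ?_
    rw [hl]
    simp [hk₀, pow_succ']
  refine exists_shortExact_of_cyclic_quotient (k₀ := k₀) (x := x) ?_ ?_ hx ?_ l ?_
    q hq hq₀ q' hq' hq₀' _ ?_
  · refine le_antisymm (fun k hk => ?_) (sup_le (fun k hk => ?_) ?_)
    · obtain ⟨r, hr⟩ := (hp k).1 hk
      refine Submodule.mem_sup.2 ⟨k - r • k₀, (hp' _).2 ⟨0, ?_⟩, r • k₀,
        Submodule.smul_mem _ _ (Submodule.mem_span_singleton_self _), sub_add_cancel _ _⟩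
      simp [hk₀, hr]
    · obtain ⟨r, hr⟩ := (hp' k).1 hk
      exact (hp k).2 ⟨r * x, by rw [← hr]; ring⟩
    · exact (Submodule.span_singleton_le_iff_mem _ _).2 ((hp k₀).2 ⟨1, by simp [hk₀]⟩)
  · intro r hr
    obtain ⟨s, hs⟩ := (hp' _).1 hr
    refine ⟨s, hdiv n ?_⟩
    rw [map_smul, hk₀] at hs
    have hs : s * x ^ (n + 1) = r * x ^ n := hs
    rw [← hs]
    ring
  · intro y hy
    have hy : x * (y : R) = 0 := congrArg Subtype.val hy
    exact Subtype.ext ((mul_left_mem_nonZeroDivisors_eq_zero_iff hxreg).1 hy)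
  · rw [hl₁, sub_self]
    exact dvd_zero x
  · intro y
    refine Ideal.mem_span_singleton_mul.trans ⟨?_, ?_⟩
    · rintro ⟨z, hz, h⟩
      exact ⟨⟨z, hz⟩, Subtype.ext h.symm⟩
    · rintro ⟨z, rfl⟩
      exact ⟨z, z.2, rfl⟩

end
end

section
/- Let (R,𝔪) be a Cohen-Macaulay local ring with canonical module that is generically Gorenstein, and let ω be a canonical ideal of R. Then there is a short exact sequence 0 → ω → R ⊕ ω/ω² → R/ω² → 0 of R-modules. -/
open CategoryTheory

noncomputable section

theorem stmt15 (R : Type) [CommRing R] [IsLocalRing R]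
    (hCM : IsCMLocalRing R) (hGG : IsGenericallyGorenstein R)
    (ω : Ideal R) (hω : IsCanonicalIdeal R ω) :
    ∃ (f : ↥ω →ₗ[R] (R × (qmod R ω (ω ^ 2))))
      (g : (R × (qmod R ω (ω ^ 2))) →ₗ[R] (R ⧸ ω ^ 2)),
      Function.Injective f ∧ Function.Exact f g ∧ Function.Surjective g := by
  let J : Submodule R ω := Submodule.comap ω.subtype (ω ^ 2)
  let i : (ω ⧸ J) →ₗ[R] (R ⧸ ω ^ 2) := Submodule.mapQ J (ω ^ 2) ω.subtype le_rfl
  let q : R →ₗ[R] (R ⧸ ω ^ 2) := Submodule.mkQ (ω ^ 2)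
  refine ⟨LinearMap.prod ω.subtype J.mkQ, q.coprod (-i), ?_, ?_, ?_⟩
  · intro x y h
    exact Subtype.ext (congrArg Prod.fst h)
  · rintro ⟨r, y⟩
    obtain ⟨y, rfl⟩ := J.mkQ_surjective y
    have key : q.coprod (-i) (r, J.mkQ y) = Submodule.Quotient.mk (r - (y : R)) := by
      rw [LinearMap.coprod_apply, LinearMap.neg_apply, ← sub_eq_add_neg]
      rfl
    constructor
    · intro h
      have hr : r - (y : R) ∈ ω ^ 2 := (Submodule.Quotient.mk_eq_zero _).mp (key.symm.trans h)
      have hrω : r ∈ ω := by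
        simpa using ω.add_mem (Ideal.pow_le_self two_ne_zero hr) y.2
      refine ⟨⟨r, hrω⟩, Prod.ext rfl ?_⟩
      exact (Submodule.Quotient.eq J).mpr hr
    · rintro ⟨x, hx⟩
      have h₁ : (x : R) = r := congrArg Prod.fst hx
      have h₂ : J.mkQ x = J.mkQ y := congrArg Prod.snd hx
      refine key.trans ((Submodule.Quotient.mk_eq_zero _).mpr ?_)
      rw [← h₁]
      exact (Submodule.Quotient.eq J).mp h₂
  · intro z
    obtain ⟨r, rfl⟩ := Submodule.mkQ_surjective (ω ^ 2) z
    refine ⟨(r, 0), ?_⟩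
    exact (LinearMap.coprod_apply _ _ _).trans (by rw [map_zero, add_zero])

end
end
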